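/- arXiv:2012.14598 — 3 statements merged into one kernel-verified Lean document; each statement's English description precedes it below -/
import Mathlib

section
/- Suppose α_v^{ij} = −β(1 − δ_{ij}) for some β > 0 and all v ∈ [d], i, j ∈ [m] (δ the Kronecker delta), and suppose that either (C1) d = 2, m ≥ 2 and β ≤ 2, or (C2) d ≥ 2, m ≥ 2 and β < 4/(d(m−1)). Then the vertex occupation measure process X(n) converges almost surely to the point (1/d, 1/d, …, 1/d) ∈ 𝔇. -/
open Filter MeasureTheory

def simplexD (d m : ℕ) : Set (Fin m → Fin d → ℝ) :=
  {x | ∀ i, (∀ v, 0 ≤ x i v) ∧ (∑ v, x i v) = 1}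

noncomputable def piMap (d m : ℕ) (α : Fin d → Fin m → Fin m → ℝ)
    (x : Fin m → Fin d → ℝ) : Fin m → Fin d → ℝ :=
  fun i v => Real.exp (∑ j, α v i j * x j v) / ∑ u, Real.exp (∑ j, α u i j * x j u)

noncomputable def occ (d m : ℕ) {Ω : Type*} (W : ℕ → Ω → Fin m → Fin d)
    (n : ℕ) (ω : Ω) : Fin m → Fin d → ℝ :=
  fun i v => (1 + ∑ k ∈ Finset.Icc 1 n, if W k ω i = v then (1 : ℝ) else 0) / (d + n)

/-- Cesàro averages inherit an eventual norm bound, up to an arbitrarily small error. -/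
theorem eventually_norm_average_le {E : Type*} [NormedAddCommGroup E] [NormedSpace ℝ E]
    {h : ℕ → E} {s t : ℝ} (hs : ∀ᶠ n in atTop, ‖h n‖ ≤ s) (hst : s < t) (hs0 : 0 ≤ s) :
    ∀ᶠ n : ℕ in atTop, ‖(n : ℝ)⁻¹ • ∑ k ∈ Finset.range n, h k‖ ≤ t := by
  have he : Tendsto (fun n => max (‖h n‖ - s) 0) atTop (nhds 0) := by
    refine tendsto_const_nhds.congr' ?_
    filter_upwards [hs] with n hn
    rw [max_eq_right (by linarith)]
  filter_upwards [he.cesaro.eventually (gt_mem_nhds (sub_pos.2 hst))] with n hn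
  have hsum : ‖∑ k ∈ Finset.range n, h k‖
      ≤ n * s + ∑ k ∈ Finset.range n, max (‖h k‖ - s) 0 := by
    calc ‖∑ k ∈ Finset.range n, h k‖ ≤ ∑ k ∈ Finset.range n, ‖h k‖ := norm_sum_le _ _
      _ ≤ ∑ k ∈ Finset.range n, (s + max (‖h k‖ - s) 0) := by
          gcongr with k
          linarith [le_max_left (‖h k‖ - s) 0]
      _ = _ := by simp [Finset.sum_add_distrib]
  rw [norm_smul, Real.norm_of_nonneg (by positivity)]
  have h1 : (n : ℝ)⁻¹ * n ≤ 1 := inv_mul_le_one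
  calc (n : ℝ)⁻¹ * ‖∑ k ∈ Finset.range n, h k‖
      ≤ (n : ℝ)⁻¹ * (n * s + ∑ k ∈ Finset.range n, max (‖h k‖ - s) 0) := by gcongr
    _ = ((n : ℝ)⁻¹ * n) * s + (n : ℝ)⁻¹ * ∑ k ∈ Finset.range n, max (‖h k‖ - s) 0 := by ring
    _ ≤ 1 * s + (t - s) := by gcongr
    _ = t := by ring

/-- A bounded sequence asymptotic to the Cesàro averages of a drift that is strictly
smaller in norm tends to zero. -/
theorem tendsto_zero_of_average_contracting {E : Type*} [NormedAddCommGroup E]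
    [NormedSpace ℝ E] {z h : ℕ → E} {φ : ℝ → ℝ} {B : ℝ} (hB : ∀ n, ‖z n‖ ≤ B)
    (hφc : Continuous φ) (hφm : MonotoneOn φ (Set.Ici 0)) (hφ : ∀ r, 0 < r → φ r < r)
    (hh : ∀ n, ‖h n‖ ≤ φ ‖z n‖)
    (hz : Tendsto (fun n => z n - (n : ℝ)⁻¹ • ∑ k ∈ Finset.range n, h k) atTop (nhds 0)) :
    Tendsto z atTop (nhds 0) := by
  set R : Set ℝ := {r | 0 ≤ r ∧ ∀ᶠ n in atTop, ‖z n‖ ≤ r} with hR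
  have hRbdd : BddBelow R := ⟨0, fun r hr => hr.1⟩
  have hRne : R.Nonempty :=
    ⟨B, (norm_nonneg _).trans (hB 0), Eventually.of_forall hB⟩
  set L := sInf R with hL
  have hL0 : 0 ≤ L := le_csInf hRne fun r hr => hr.1
  have hmem : ∀ r, L < r → ∀ᶠ n in atTop, ‖z n‖ ≤ r := by
    intro r hr
    obtain ⟨s, hs, hsr⟩ := exists_lt_of_csInf_lt hRne hr
    exact hs.2.mono fun n hn => hn.trans hsr.le
  have hLz : L = 0 := by
    by_contra hne
    have hLpos : 0 < L := lt_of_le_of_ne hL0 (Ne.symm hne)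
    have hev : ∀ᶠ r in nhdsWithin L (Set.Ioi L), φ r < L :=
      (hφc.continuousAt.eventually (gt_mem_nhds (hφ L hLpos))).filter_mono
        nhdsWithin_le_nhds
    obtain ⟨r, hrL, hr⟩ := (hev.and self_mem_nhdsWithin).exists
    have hr' : L < r := hr
    have hbound : ∀ᶠ n in atTop, ‖h n‖ ≤ φ r := by
      filter_upwards [hmem r hr'] with n hn
      exact (hh n).trans (hφm (norm_nonneg _) (hL0.trans hr'.le) hn)
    obtain ⟨n₀, hn₀⟩ := hbound.exists
    have hφr : 0 ≤ φ r := (norm_nonneg _).trans hn₀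
    set ε := (L - φ r) / 3 with hε
    have hεpos : 0 < ε := by rw [hε]; linarith
    have havg := eventually_norm_average_le hbound (t := φ r + ε) (by linarith) hφr
    have hdiff := hz.norm.eventually (gt_mem_nhds (by simpa using hεpos))
    have hnew : φ r + 2 * ε ∈ R := by
      refine ⟨by linarith, ?_⟩
      filter_upwards [havg, hdiff] with n h1 h2
      have := norm_add_le (z n - (n : ℝ)⁻¹ • ∑ k ∈ Finset.range n, h k)
        ((n : ℝ)⁻¹ • ∑ k ∈ Finset.range n, h k)
      rw [sub_add_cancel] at this
      linarith
    have := csInf_le hRbdd hnew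
    rw [← hL] at this
    linarith
  rw [tendsto_zero_iff_norm_tendsto_zero, Metric.tendsto_atTop]
  intro ε hε
  obtain ⟨N, hN⟩ := eventually_atTop.1 (hmem (ε / 2) (by rw [hLz]; linarith))
  refine ⟨N, fun n hn => ?_⟩
  have := hN n hn
  rw [Real.dist_eq, sub_zero, abs_of_nonneg (norm_nonneg _)]
  linarith

/-- A real sequence asymptotic to the Cesàro averages of a drift that asymptotically
points towards the origin tends to zero. -/
theorem tendsto_zero_of_average_restoring {z h : ℕ → ℝ} {f : ℝ → ℝ} {K : ℝ}
    (hf : ∀ x y, |f x - f y| ≤ K * |x - y|) (hf0 : f 0 = 0) (hsign : ∀ x, 0 ≤ x * f x)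
    (hh : Tendsto (fun n => h n + f (z n)) atTop (nhds 0))
    (hz : Tendsto (fun n => z n - (n : ℝ)⁻¹ * ∑ k ∈ Finset.range n, h k) atTop (nhds 0)) :
    Tendsto z atTop (nhds 0) := by
  set S : ℕ → ℝ := fun n => ∑ k ∈ Finset.range n, h k with hS
  set A : ℕ → ℝ := fun n => (n : ℝ)⁻¹ * S n with hA
  set e : ℕ → ℝ := fun n => h n + f (A n) with he
  have he0 : Tendsto e atTop (nhds 0) := by
    have hd : Tendsto (fun n => f (A n) - f (z n)) atTop (nhds 0) := by
      refine squeeze_zero_norm (a := fun n => K * |z n - A n|) (fun n => ?_) ?_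
      · rw [Real.norm_eq_abs, abs_sub_comm (z n)]
        exact hf _ _
      · simpa using hz.abs.const_mul K
    have := hh.add hd
    rw [add_zero] at this
    refine this.congr fun n => ?_
    simp only [he]
    ring
  obtain ⟨N, hN⟩ := exists_nat_ge (max K 1)
  have hstep : ∀ n, N ≤ n → |S (n + 1)| ≤ |S n| + |e n| := by
    intro n hn
    have hnK : max K 1 ≤ n := hN.trans (by exact_mod_cast hn)
    have hn1 : (1 : ℝ) ≤ n := (le_max_right _ _).trans hnK
    have hKn : K ≤ n := (le_max_left _ _).trans hnK
    have hSA : S n = n * A n := by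
      simp only [hA]
      field_simp
    have hSe : S (n + 1) = (n * A n - f (A n)) + e n := by
      rw [← hSA]
      simp only [hS, he, Finset.sum_range_succ]
      ring
    have hfA : |f (A n)| ≤ n * |A n| := by
      have := hf (A n) 0
      rw [hf0, sub_zero, sub_zero] at this
      exact this.trans (by gcongr)
    have hcore : |n * A n - f (A n)| ≤ |n * A n| := by
      rw [abs_mul, Nat.abs_cast]
      have hs := hsign (A n)
      rw [abs_le] at hfA ⊢
      rcases lt_trichotomy (A n) 0 with hneg | hzero | hpos
      · have : f (A n) ≤ 0 := by nlinarith
        rw [abs_of_neg hneg] at hfA ⊢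
        constructor <;> nlinarith
      · simp [hzero, hf0]
      · have : 0 ≤ f (A n) := by nlinarith
        rw [abs_of_pos hpos] at hfA ⊢
        constructor <;> nlinarith
    rw [hSe, hSA]
    exact (abs_add_le _ _).trans (by linarith)
  have hbound : ∀ n, N ≤ n → |S n| ≤ |S N| + ∑ k ∈ Finset.range n, |e k| := by
    intro n hn
    induction n, hn using Nat.le_induction with
    | base =>
      have : 0 ≤ ∑ k ∈ Finset.range N, |e k| := Finset.sum_nonneg fun _ _ => abs_nonneg _
      linarith
    | succ n hn ih =>
      rw [Finset.sum_range_succ]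
      linarith [hstep n hn]
  have hA0 : Tendsto A atTop (nhds 0) := by
    have habs : Tendsto (fun n => |e n|) atTop (nhds 0) := by simpa using he0.abs
    have hlim : Tendsto (fun n : ℕ => (n : ℝ)⁻¹ * |S N|
        + (n : ℝ)⁻¹ * ∑ k ∈ Finset.range n, |e k|) atTop (nhds 0) := by
      have h1 : Tendsto (fun n : ℕ => (n : ℝ)⁻¹ * |S N|) atTop (nhds 0) := by
        simpa using (tendsto_inv_atTop_nhds_zero_nat (𝕜 := ℝ)).mul_const |S N|
      simpa using h1.add habs.cesaro
    refine squeeze_zero_norm' ?_ hlim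
    filter_upwards [eventually_ge_atTop N] with n hn
    simp only [hA]
    rw [Real.norm_eq_abs, abs_mul, abs_of_nonneg (by positivity : (0 : ℝ) ≤ (n : ℝ)⁻¹),
      ← mul_add]
    gcongr
    exact hbound n hn
  have hsum := hz.add hA0
  rw [add_zero] at hsum
  exact hsum.congr fun n => sub_add_cancel _ _

theorem tanh_sub_tanh (a b : ℝ) :
    Real.tanh a - Real.tanh b = Real.sinh (a - b) / (Real.cosh a * Real.cosh b) := by
  have := (Real.cosh_pos a).ne'
  have := (Real.cosh_pos b).ne'
  rw [Real.tanh_eq_sinh_div_cosh, Real.tanh_eq_sinh_div_cosh, Real.sinh_sub]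
  field_simp

theorem monotone_tanh : Monotone Real.tanh := by
  intro a b hab
  rw [← sub_nonneg, tanh_sub_tanh]
  have := Real.sinh_nonneg_iff.2 (sub_nonneg.2 hab)
  have := Real.cosh_pos a
  have := Real.cosh_pos b
  positivity

theorem continuous_tanh : Continuous Real.tanh := by
  have : Real.tanh = fun x => Real.sinh x / Real.cosh x :=
    funext Real.tanh_eq_sinh_div_cosh
  rw [this]
  exact Real.continuous_sinh.div Real.continuous_cosh fun x => (Real.cosh_pos x).ne'

theorem tanh_lt_self {x : ℝ} (hx : 0 < x) : Real.tanh x < x := by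
  obtain ⟨c, hc, hc'⟩ := exists_deriv_eq_slope Real.sinh hx
    Real.continuous_sinh.continuousOn Real.differentiable_sinh.differentiableOn
  rw [Real.deriv_sinh, Real.sinh_zero, sub_zero, sub_zero, eq_div_iff hx.ne'] at hc'
  rw [Real.tanh_eq_sinh_div_cosh, div_lt_iff₀ (Real.cosh_pos x), ← hc', mul_comm]
  gcongr
  rw [Real.cosh_lt_cosh, abs_of_pos hc.1, abs_of_pos hx]
  exact hc.2

theorem abs_tanh_sub_tanh_le (a b : ℝ) :
    |Real.tanh a - Real.tanh b| ≤ 2 * Real.tanh (|a - b| / 2) := by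
  wlog hab : b ≤ a generalizing a b
  · rw [abs_sub_comm, abs_sub_comm a]
    exact this b a (le_of_not_ge hab)
  rw [abs_of_nonneg (sub_nonneg.2 (monotone_tanh hab)), abs_of_nonneg (sub_nonneg.2 hab),
    tanh_sub_tanh]
  set c := (a - b) / 2 with hc
  have hc0 : 0 ≤ c := by rw [hc]; linarith
  have hac : a - b = 2 * c := by rw [hc]; ring
  have hprod : Real.cosh c ^ 2 ≤ Real.cosh a * Real.cosh b := by
    have h1 : Real.cosh (a - b) = 2 * Real.cosh c ^ 2 - 1 := by
      rw [hac, Real.cosh_two_mul, Real.sinh_sq]; ring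
    rw [Real.cosh_sub] at h1
    have h2 := Real.one_le_cosh (a + b)
    rw [Real.cosh_add] at h2
    linarith
  have hs := Real.sinh_nonneg_iff.2 hc0
  have hcp := Real.cosh_pos c
  rw [hac, Real.sinh_two_mul, Real.tanh_eq_sinh_div_cosh]
  calc 2 * Real.sinh c * Real.cosh c / (Real.cosh a * Real.cosh b)
      ≤ 2 * Real.sinh c * Real.cosh c / Real.cosh c ^ 2 := by gcongr
    _ = 2 * (Real.sinh c / Real.cosh c) := by field_simp

theorem tanh_le_self {x : ℝ} (hx : 0 ≤ x) : Real.tanh x ≤ x := by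
  rcases hx.eq_or_lt with rfl | hx
  · simp
  · exact (tanh_lt_self hx).le

theorem abs_tanh_sub_tanh_le_abs_sub (a b : ℝ) :
    |Real.tanh a - Real.tanh b| ≤ |a - b| := by
  have := tanh_le_self (by positivity : 0 ≤ |a - b| / 2)
  linarith [abs_tanh_sub_tanh_le a b]

theorem exp_sub_exp_div_add (a b : ℝ) :
    (Real.exp a - Real.exp b) / (Real.exp a + Real.exp b) = Real.tanh ((a - b) / 2) := by
  have ha : Real.exp a = Real.exp ((a + b) / 2) * Real.exp ((a - b) / 2) := by
    rw [← Real.exp_add]; ring_nf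
  have hb : Real.exp b = Real.exp ((a + b) / 2) * Real.exp (-((a - b) / 2)) := by
    rw [← Real.exp_add]; ring_nf
  rw [Real.tanh_eq, ha, hb, ← mul_sub, ← mul_add, mul_div_mul_left _ _ (Real.exp_pos _).ne']

/-- Strong law of large numbers for bounded martingale differences. -/
theorem ae_tendsto_average_of_bounded_martingale_difference {Ω : Type*}
    {m0 : MeasurableSpace Ω} (μ : Measure Ω) [IsProbabilityMeasure μ] (ℱ : Filtration ℕ m0)
    (ξ : ℕ → Ω → ℝ) (C : ℝ) (hmeas : ∀ k, StronglyMeasurable[ℱ (k + 1)] (ξ k))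
    (hbdd : ∀ k ω, |ξ k ω| ≤ C) (hcond : ∀ k, μ[ξ k | ℱ k] =ᵐ[μ] 0) :
    ∀ᵐ ω ∂μ, Tendsto (fun n : ℕ => (n : ℝ)⁻¹ * ∑ k ∈ Finset.range n, ξ k ω) atTop
      (nhds 0) := by
  have hC : 0 ≤ C := by
    obtain ⟨ω⟩ : Nonempty Ω := μ.nonempty_of_neZero
    exact (abs_nonneg _).trans (hbdd 0 ω)
  set S : ℕ → Ω → ℝ := fun n ω => ∑ k ∈ Finset.range n, ξ k ω with hS
  have hSm : ∀ n, StronglyMeasurable[ℱ n] (S n) := fun n =>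
    Finset.stronglyMeasurable_fun_sum _ fun k hk =>
      (hmeas k).mono (ℱ.mono (Finset.mem_range.1 hk))
  have hSm0 : ∀ n, StronglyMeasurable (S n) := fun n => (hSm n).mono (ℱ.le n)
  have hξm0 : ∀ n, StronglyMeasurable (ξ n) := fun n => (hmeas n).mono (ℱ.le _)
  have hSb : ∀ n ω, |S n ω| ≤ n * C := fun n ω => by
    refine (Finset.abs_sum_le_sum_abs _ _).trans ?_
    simpa using Finset.sum_le_sum fun k (_ : k ∈ Finset.range n) => hbdd k ω
  have hint : ∀ {f : Ω → ℝ} (D : ℝ), StronglyMeasurable f → (∀ ω, |f ω| ≤ D) →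
      Integrable f μ := fun D hf hD =>
    Integrable.of_bound hf.aestronglyMeasurable D (Eventually.of_forall hD)
  have hSξ : ∀ n, Integrable (S n * ξ n) μ := fun n =>
    hint (n * C * C) ((hSm0 n).mul (hξm0 n)) fun ω => by
      rw [Pi.mul_apply, abs_mul]
      exact mul_le_mul (hSb n ω) (hbdd n ω) (abs_nonneg _) (by positivity)
  have hcross : ∀ n, ∫ ω, S n ω * ξ n ω ∂μ = 0 := by
    intro n
    have h1 := condExp_mul_of_stronglyMeasurable_left (hSm n) (hSξ n)
      (hint C (hξm0 n) (hbdd n))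
    have h2 : μ[S n * ξ n | ℱ n] =ᵐ[μ] 0 := by
      filter_upwards [h1, hcond n] with ω h1 h2
      simp [h1, h2]
    have h3 := integral_condExp (ℱ.le n) (f := S n * ξ n) (μ := μ)
    rw [integral_congr_ae h2] at h3
    simpa using h3.symm
  have hS2 : ∀ n, Integrable (fun ω => S n ω ^ 2) μ := fun n =>
    hint ((n * C) ^ 2) ((hSm0 n).pow 2) fun ω => by
      rw [abs_pow]
      exact pow_le_pow_left₀ (abs_nonneg _) (hSb n ω) 2
  have hξ2 : ∀ n, Integrable (fun ω => ξ n ω ^ 2) μ := fun n =>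
    hint (C ^ 2) ((hξm0 n).pow 2) fun ω => by
      rw [abs_pow]
      exact pow_le_pow_left₀ (abs_nonneg _) (hbdd n ω) 2
  have hvar : ∀ n, ∫ ω, S n ω ^ 2 ∂μ ≤ n * C ^ 2 := by
    intro n
    induction n with
    | zero => simp [hS]
    | succ n ih =>
      have hexp : ∀ ω, S (n + 1) ω ^ 2 = S n ω ^ 2 + 2 * (S n ω * ξ n ω) + ξ n ω ^ 2 := by
        intro ω
        simp only [hS, Finset.sum_range_succ]
        ring
      have hξle : ∫ ω, ξ n ω ^ 2 ∂μ ≤ C ^ 2 := by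
        calc ∫ ω, ξ n ω ^ 2 ∂μ ≤ ∫ _, C ^ 2 ∂μ :=
              integral_mono (hξ2 n) (integrable_const _) fun ω => sq_le_sq'
                (abs_le.1 (hbdd n ω)).1 (abs_le.1 (hbdd n ω)).2
          _ = C ^ 2 := by simp
      have hSξ' : Integrable (fun ω => 2 * (S n ω * ξ n ω)) μ := (hSξ n).const_mul 2
      simp_rw [hexp]
      have h1 := integral_add ((hS2 n).add hSξ') (hξ2 n)
      have h2 := integral_add (hS2 n) hSξ'
      rw [integral_const_mul, hcross] at h2
      simp only [Pi.add_apply] at h1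
      rw [h1, h2]
      push_cast
      linarith
  have hsq : ∀ᵐ ω ∂μ, Tendsto (fun n : ℕ => S (n ^ 2) ω / (n : ℝ) ^ 2) atTop (nhds 0) := by
    set F : ℕ → Ω → ENNReal := fun n ω => ENNReal.ofReal ((S (n ^ 2) ω / (n : ℝ) ^ 2) ^ 2)
      with hF
    have hFm : ∀ n, Measurable (F n) := fun n =>
      (((hSm0 _).measurable.div_const _).pow_const 2).ennreal_ofReal
    have hFint : ∀ n, ∫⁻ ω, F n ω ∂μ ≤ ENNReal.ofReal (C ^ 2 * (1 / (n : ℝ) ^ 2)) := by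
      intro n
      have hi : Integrable (fun ω => (S (n ^ 2) ω / (n : ℝ) ^ 2) ^ 2) μ := by
        simp_rw [div_pow]
        exact (hS2 _).div_const _
      rw [← ofReal_integral_eq_lintegral_ofReal hi (Eventually.of_forall fun ω => sq_nonneg _)]
      refine ENNReal.ofReal_le_ofReal ?_
      simp_rw [div_pow]
      rw [integral_div]
      rcases Nat.eq_zero_or_pos n with rfl | hn
      · simp
      · have hn' : (0 : ℝ) < n := by exact_mod_cast hn
        rw [div_le_iff₀ (by positivity)]
        refine (hvar (n ^ 2)).trans (le_of_eq ?_)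
        push_cast
        field_simp
    have hsum : ∫⁻ ω, ∑' n, F n ω ∂μ ≠ ⊤ := by
      rw [lintegral_tsum fun n => (hFm n).aemeasurable]
      refine ne_top_of_le_ne_top ?_ (ENNReal.tsum_le_tsum hFint)
      have : Summable fun n : ℕ => C ^ 2 * (1 / (n : ℝ) ^ 2) :=
        (Real.summable_one_div_nat_pow.2 one_lt_two).mul_left _
      exact this.tsum_ofReal_ne_top
    filter_upwards [ae_lt_top (Measurable.tsum hFm) hsum] with ω hω
    have h0 := ENNReal.tendsto_atTop_zero_of_tsum_ne_top hω.ne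
    have h1 := (ENNReal.tendsto_toReal ENNReal.zero_ne_top).comp h0
    have h2 : Tendsto (fun n : ℕ => (S (n ^ 2) ω / (n : ℝ) ^ 2) ^ 2) atTop (nhds 0) := by
      refine h1.congr fun n => ?_
      simp only [Function.comp, hF]
      exact ENNReal.toReal_ofReal (sq_nonneg _)
    have h3 := h2.sqrt
    simp_rw [Real.sqrt_sq_eq_abs, Real.sqrt_zero] at h3
    exact (tendsto_zero_iff_abs_tendsto_zero _).2 h3
  filter_upwards [hsq] with ω hω
  have hdiff : ∀ p q, p ≤ q → |S q ω - S p ω| ≤ (q - p : ℝ) * C := by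
    intro p q hpq
    simp only [hS]
    rw [← Finset.sum_Ico_eq_sub _ hpq]
    refine (Finset.abs_sum_le_sum_abs _ _).trans ?_
    refine (Finset.sum_le_sum fun k _ => hbdd k ω).trans (le_of_eq ?_)
    rw [Finset.sum_const, Nat.card_Ico, nsmul_eq_mul, Nat.cast_sub hpq]
  have hsqrt : Tendsto Nat.sqrt atTop atTop := by
    refine tendsto_atTop.2 fun b => ?_
    filter_upwards [eventually_ge_atTop (b * b)] with n hn
    exact Nat.le_sqrt.2 hn
  have hinv : Tendsto (fun k : ℕ => 3 * C * (k : ℝ)⁻¹) atTop (nhds 0) := by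
    simpa using (tendsto_inv_atTop_nhds_zero_nat (𝕜 := ℝ)).const_mul (3 * C)
  have habs : Tendsto (fun k : ℕ => |S (k ^ 2) ω / (k : ℝ) ^ 2|) atTop (nhds 0) := by
    simpa using hω.abs
  have hlim := (habs.add hinv).comp hsqrt
  rw [add_zero] at hlim
  refine squeeze_zero_norm' ?_ hlim
  filter_upwards [eventually_ge_atTop 1] with n hn
  set k := Nat.sqrt n with hk
  have hk1 : 1 ≤ k := Nat.le_sqrt.2 (by simpa using hn)
  have hkn : k ^ 2 ≤ n := Nat.sqrt_le' n
  have hnk : n ≤ k ^ 2 + 2 * k := by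
    have := Nat.sqrt_le_add n
    rw [← hk] at this
    nlinarith
  have hk1' : (1 : ℝ) ≤ k := by exact_mod_cast hk1
  have hkn' : (k : ℝ) ^ 2 ≤ n := by exact_mod_cast hkn
  have hnk' : (n : ℝ) ≤ k ^ 2 + 2 * k := by exact_mod_cast hnk
  have hd := hdiff (k ^ 2) n hkn
  push_cast at hd
  have hSn : |S n ω| ≤ |S (k ^ 2) ω| + 2 * k * C := by
    have h1 := abs_add_le (S n ω - S (k ^ 2) ω) (S (k ^ 2) ω)
    rw [sub_add_cancel] at h1
    have h2 : ((n : ℝ) - k ^ 2) * C ≤ 2 * k * C := by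
      gcongr
      linarith
    linarith
  have hn0 : (0 : ℝ) < n := by exact_mod_cast hn
  simp only [Function.comp, ← hk]
  rw [Real.norm_eq_abs, abs_mul, abs_of_pos (inv_pos.2 hn0), abs_div,
    abs_of_pos (by positivity : (0 : ℝ) < (k : ℝ) ^ 2)]
  calc (n : ℝ)⁻¹ * |S n ω| ≤ ((k : ℝ) ^ 2)⁻¹ * (|S (k ^ 2) ω| + 3 * k * C) := by
        gcongr
        refine hSn.trans ?_
        gcongr
        norm_num
    _ = |S (k ^ 2) ω| / (k : ℝ) ^ 2 + 3 * C * (k : ℝ)⁻¹ := by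
        field_simp

theorem abs_tanh_le (x : ℝ) : |Real.tanh x| ≤ |x| := by
  simpa using abs_tanh_sub_tanh_le_abs_sub x 0

theorem sum_exponent_sub_sum_exponent {d m : ℕ} {β : ℝ} {α : Fin d → Fin m → Fin m → ℝ}
    (hα : ∀ v i j, α v i j = if i = j then 0 else -β) (x : Fin m → Fin d → ℝ)
    (i : Fin m) (v w : Fin d) :
    ∑ j, α v i j * x j v - ∑ j, α w i j * x j w
      = -β * ∑ j ∈ Finset.univ.erase i, (x j v - x j w) := by
  rw [← Finset.sum_sub_distrib, ← Finset.add_sum_erase _ _ (Finset.mem_univ i),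
    Finset.mul_sum]
  simp only [hα, if_true, zero_mul, sub_zero, zero_add]
  refine Finset.sum_congr rfl fun j hj => ?_
  rw [if_neg (Finset.ne_of_mem_erase hj).symm]
  ring

theorem abs_piMap_sub_piMap_le {d m : ℕ} {β : ℝ} {α : Fin d → Fin m → Fin m → ℝ}
    (hα : ∀ v i j, α v i j = if i = j then 0 else -β) (x : Fin m → Fin d → ℝ)
    (i : Fin m) {v w : Fin d} (hvw : v ≠ w) :
    |piMap d m α x i v - piMap d m α x i w|
      ≤ |β| / 2 * |∑ j ∈ Finset.univ.erase i, (x j v - x j w)| := by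
  have hle : Real.exp (∑ j, α v i j * x j v) + Real.exp (∑ j, α w i j * x j w)
      ≤ ∑ u, Real.exp (∑ j, α u i j * x j u) := by
    rw [← Finset.sum_pair (f := fun u => Real.exp (∑ j, α u i j * x j u)) hvw]
    exact Finset.sum_le_sum_of_subset_of_nonneg (Finset.subset_univ _)
      fun _ _ _ => (Real.exp_pos _).le
  have hpos : 0 < Real.exp (∑ j, α v i j * x j v) + Real.exp (∑ j, α w i j * x j w) := by
    positivity
  unfold piMap
  rw [← sub_div, abs_div, abs_of_pos (hpos.trans_le hle)]
  refine (div_le_div_of_nonneg_left (abs_nonneg _) hpos hle).trans ?_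
  rw [← abs_of_pos hpos, ← abs_div, exp_sub_exp_div_add, sum_exponent_sub_sum_exponent hα]
  refine (abs_tanh_le _).trans (le_of_eq ?_)
  rw [abs_div, abs_mul, abs_neg, abs_two]
  ring

theorem piMap_two_sub_piMap {m : ℕ} {β : ℝ} {α : Fin 2 → Fin m → Fin m → ℝ}
    (hα : ∀ v i j, α v i j = if i = j then 0 else -β) (x : Fin m → Fin 2 → ℝ)
    (i : Fin m) {v w : Fin 2} (hvw : v ≠ w) :
    piMap 2 m α x i v - piMap 2 m α x i w
      = Real.tanh (-(β / 2) * ∑ j ∈ Finset.univ.erase i, (x j v - x j w)) := by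
  have huniv : (Finset.univ : Finset (Fin 2)) = {v, w} := by
    symm
    rw [← Finset.card_eq_iff_eq_univ, Finset.card_pair hvw, Fintype.card_fin]
  unfold piMap
  rw [← sub_div, huniv, Finset.sum_pair hvw, exp_sub_exp_div_add,
    sum_exponent_sub_sum_exponent hα]
  congr 1
  ring

theorem abs_sub_le_one_of_mem_simplexD {d m : ℕ} {x : Fin m → Fin d → ℝ}
    (hx : x ∈ simplexD d m) (i : Fin m) (v w : Fin d) : |x i v - x i w| ≤ 1 := by
  have hle : ∀ u, x i u ≤ 1 := fun u => by
    rw [← (hx i).2]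
    exact Finset.single_le_sum (fun u _ => (hx i).1 u) (Finset.mem_univ u)
  rw [abs_le]
  constructor <;> linarith [hle v, hle w, (hx i).1 v, (hx i).1 w]

theorem average_sub {d m : ℕ} {x : ℕ → Fin m → Fin d → ℝ} {p : ℕ → Fin m → Fin d → ℝ}
    (havg : ∀ i v, Tendsto (fun n => x n i v - (n : ℝ)⁻¹ * ∑ k ∈ Finset.range n, p k i v)
      atTop (nhds 0)) (i j : Fin m) (v w : Fin d) :
    Tendsto (fun n => (x n i v - x n j w)
      - (n : ℝ)⁻¹ * ∑ k ∈ Finset.range n, (p k i v - p k j w)) atTop (nhds 0) := by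
  have h := (havg i v).sub (havg j w)
  rw [sub_zero] at h
  refine h.congr fun n => ?_
  rw [Finset.sum_sub_distrib]
  ring

/-- When the softmax map is a contraction, coordinate differences vanish asymptotically. -/
theorem tendsto_sub_of_contracting {d m : ℕ} {β : ℝ} (hβ : 0 < β) (hm : 1 ≤ m)
    (hsmall : β * ((m : ℝ) - 1) < 2) {α : Fin d → Fin m → Fin m → ℝ}
    (hα : ∀ v i j, α v i j = if i = j then 0 else -β) {x : ℕ → Fin m → Fin d → ℝ}
    (hx : ∀ n, x n ∈ simplexD d m)
    (havg : ∀ i v, Tendsto (fun n => x n i v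
      - (n : ℝ)⁻¹ * ∑ k ∈ Finset.range n, piMap d m α (x k) i v) atTop (nhds 0))
    {v w : Fin d} (hvw : v ≠ w) (i : Fin m) :
    Tendsto (fun n => x n i v - x n i w) atTop (nhds 0) := by
  have hm' : (0 : ℝ) ≤ (m : ℝ) - 1 := by
    have : (1 : ℝ) ≤ m := by exact_mod_cast hm
    linarith
  have hc : 0 ≤ β * ((m : ℝ) - 1) / 2 := by positivity
  have key : Tendsto (fun n i => x n i v - x n i w) atTop (nhds (0 : Fin m → ℝ)) := by
    refine tendsto_zero_of_average_contracting (B := 1)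
      (h := fun n i => piMap d m α (x n) i v - piMap d m α (x n) i w)
      (φ := fun r => β * ((m : ℝ) - 1) / 2 * r) (fun n => ?_) (by fun_prop) ?_ ?_
      (fun n => ?_) ?_
    · exact (pi_norm_le_iff_of_nonneg zero_le_one).2 fun i =>
        abs_sub_le_one_of_mem_simplexD (hx n) i v w
    · exact fun a _ b _ hab => mul_le_mul_of_nonneg_left hab hc
    · intro r hr
      have := mul_lt_mul_of_pos_right hsmall hr
      linarith
    · refine (pi_norm_le_iff_of_nonneg (by positivity)).2 fun i => ?_
      rw [Real.norm_eq_abs]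
      refine (abs_piMap_sub_piMap_le hα (x n) i hvw).trans ?_
      set N := ‖fun i => x n i v - x n i w‖ with hN
      have hsum : |∑ j ∈ Finset.univ.erase i, (x n j v - x n j w)| ≤ ((m : ℝ) - 1) * N := by
        refine (Finset.abs_sum_le_sum_abs _ _).trans ?_
        refine (Finset.sum_le_sum fun j _ =>
          norm_le_pi_norm (fun i => x n i v - x n i w) j).trans (le_of_eq ?_)
        rw [Finset.sum_const, Finset.card_erase_of_mem (Finset.mem_univ i), Finset.card_univ,
          Fintype.card_fin, nsmul_eq_mul, Nat.cast_sub hm, Nat.cast_one]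
      rw [abs_of_pos hβ]
      calc β / 2 * |∑ j ∈ Finset.univ.erase i, (x n j v - x n j w)|
          ≤ β / 2 * (((m : ℝ) - 1) * N) := by gcongr
        _ = β * ((m : ℝ) - 1) / 2 * N := by ring
    · rw [tendsto_pi_nhds]
      intro i
      refine (average_sub havg i i v w).congr fun n => ?_
      simp
  exact (tendsto_pi_nhds.1 key) i

/-- With two vertices and `β ≤ 2`, coordinate differences vanish asymptotically: the walks
first synchronize, and the common value is then driven to zero. -/
theorem tendsto_sub_of_two_vertices {m : ℕ} {β : ℝ} (hβ : 0 < β) (hm : 1 ≤ m) (hβ2 : β ≤ 2)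
    {α : Fin 2 → Fin m → Fin m → ℝ}
    (hα : ∀ v i j, α v i j = if i = j then 0 else -β) {x : ℕ → Fin m → Fin 2 → ℝ}
    (hx : ∀ n, x n ∈ simplexD 2 m)
    (havg : ∀ i v, Tendsto (fun n => x n i v
      - (n : ℝ)⁻¹ * ∑ k ∈ Finset.range n, piMap 2 m α (x k) i v) atTop (nhds 0))
    {v w : Fin 2} (hvw : v ≠ w) (i : Fin m) :
    Tendsto (fun n => x n i v - x n i w) atTop (nhds 0) := by
  set z : Fin m → ℕ → ℝ := fun i n => x n i v - x n i w with hz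
  set h : Fin m → ℕ → ℝ := fun i n =>
    Real.tanh (-(β / 2) * ∑ j ∈ Finset.univ.erase i, z j n) with hh
  have hzh : ∀ i, Tendsto (fun n => z i n - (n : ℝ)⁻¹ * ∑ k ∈ Finset.range n, h i k)
      atTop (nhds 0) := fun i => by
    simpa only [piMap_two_sub_piMap hα _ _ hvw] using average_sub havg i i v w
  have hsync : ∀ i j, Tendsto (fun n => z i n - z j n) atTop (nhds 0) := by
    intro i j
    refine tendsto_zero_of_average_contracting (B := 2) (h := fun n => h i n - h j n)
      (φ := fun r => 2 * Real.tanh (β * r / 4)) (fun n => ?_) ?_ ?_ ?_ (fun n => ?_) ?_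
    · have h1 := abs_sub_le_one_of_mem_simplexD (hx n) i v w
      have h2 := abs_sub_le_one_of_mem_simplexD (hx n) j v w
      refine (norm_sub_le _ _).trans ?_
      simp only [hz, Real.norm_eq_abs]
      linarith
    · exact (continuous_tanh.comp (by fun_prop)).const_mul 2
    · intro a _ b _ hab
      have : β * a / 4 ≤ β * b / 4 := by gcongr
      have := monotone_tanh this
      simp only
      linarith
    · intro r hr
      have := tanh_lt_self (by positivity : 0 < β * r / 4)
      nlinarith
    · rw [Real.norm_eq_abs, Real.norm_eq_abs]
      refine (abs_tanh_sub_tanh_le _ _).trans (le_of_eq ?_)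
      rw [Finset.sum_erase_eq_sub (Finset.mem_univ i),
        Finset.sum_erase_eq_sub (Finset.mem_univ j)]
      have harg : -(β / 2) * (∑ l, z l n - z i n) - -(β / 2) * (∑ l, z l n - z j n)
          = β / 2 * (z i n - z j n) := by ring
      rw [harg, abs_mul, abs_of_pos (by positivity : 0 < β / 2)]
      ring_nf
    · have h1 := (hzh i).sub (hzh j)
      rw [sub_zero] at h1
      refine h1.congr fun n => ?_
      rw [smul_eq_mul, Finset.sum_sub_distrib]
      ring
  set c := β / 2 * ((m : ℝ) - 1) with hc
  have hc0 : 0 ≤ c := by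
    have : (1 : ℝ) ≤ m := by exact_mod_cast hm
    have : 0 ≤ (m : ℝ) - 1 := by linarith
    positivity
  refine tendsto_zero_of_average_restoring (K := c) (f := fun y => Real.tanh (c * y))
    (fun a b => ?_) (by simp) (fun a => ?_) ?_ (hzh i)
  · refine (abs_tanh_sub_tanh_le_abs_sub _ _).trans (le_of_eq ?_)
    rw [← mul_sub, abs_mul, abs_of_nonneg hc0]
  · rcases le_total 0 a with ha | ha
    · have := monotone_tanh (by positivity : 0 ≤ c * a)
      rw [Real.tanh_zero] at this
      positivity
    · have := monotone_tanh (mul_nonpos_of_nonneg_of_nonpos hc0 ha)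
      rw [Real.tanh_zero] at this
      exact mul_nonneg_of_nonpos_of_nonpos ha this
  · have hsum : Tendsto (fun n => |β / 2 * ∑ j ∈ Finset.univ.erase i, (z i n - z j n)|)
        atTop (nhds 0) := by
      have h1 := tendsto_finsetSum (Finset.univ.erase i) fun j _ => hsync i j
      simpa using (h1.const_mul (β / 2)).abs
    refine squeeze_zero_norm (fun n => ?_) hsum
    simp only [hh]
    rw [neg_mul, Real.tanh_neg, neg_add_eq_sub, Real.norm_eq_abs]
    refine (abs_tanh_sub_tanh_le_abs_sub _ _).trans (le_of_eq ?_)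
    have hsplit : ∑ j ∈ Finset.univ.erase i, (z i n - z j n)
        = ((m : ℝ) - 1) * z i n - ∑ j ∈ Finset.univ.erase i, z j n := by
      rw [Finset.sum_sub_distrib, Finset.sum_const,
        Finset.card_erase_of_mem (Finset.mem_univ i), Finset.card_univ,
        Fintype.card_fin, nsmul_eq_mul, Nat.cast_sub hm, Nat.cast_one]
    rw [hsplit, hc]
    congr 1
    ring

/-- A simplex-valued sequence whose coordinate differences vanish tends to the uniform
point. -/
theorem tendsto_uniform_of_tendsto_sub {d m : ℕ} (hd : 0 < d) {x : ℕ → Fin m → Fin d → ℝ}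
    (hx : ∀ n, x n ∈ simplexD d m)
    (hsub : ∀ i v w, v ≠ w → Tendsto (fun n => x n i v - x n i w) atTop (nhds 0)) :
    Tendsto x atTop (nhds fun _ _ => 1 / (d : ℝ)) := by
  have hd' : (d : ℝ) ≠ 0 := by exact_mod_cast hd.ne'
  rw [tendsto_pi_nhds]
  intro i
  rw [tendsto_pi_nhds]
  intro v
  have hsub' : ∀ w, Tendsto (fun n => x n i v - x n i w) atTop (nhds 0) := by
    intro w
    by_cases hvw : v = w
    · simp [hvw]
    · exact hsub i v w hvw
  have h1 := ((tendsto_finsetSum Finset.univ fun w _ => hsub' w).div_const (d : ℝ)).const_add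
    (1 / (d : ℝ))
  simp only [Finset.sum_const_zero, zero_div, add_zero] at h1
  refine h1.congr fun n => ?_
  rw [Finset.sum_sub_distrib, (hx n i).2, Finset.sum_const, Finset.card_univ,
    Fintype.card_fin, nsmul_eq_mul]
  field_simp
  ring

theorem occ_mem_simplexD {d m : ℕ} (hd : 0 < d) {Ω : Type*} (W : ℕ → Ω → Fin m → Fin d)
    (n : ℕ) (ω : Ω) : occ d m W n ω ∈ simplexD d m := by
  have hd' : (0 : ℝ) < d := by exact_mod_cast hd
  refine fun i => ⟨fun v => ?_, ?_⟩
  · refine div_nonneg (add_nonneg zero_le_one (Finset.sum_nonneg fun k _ => ?_)) (by positivity)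
    split_ifs <;> norm_num
  · simp only [occ]
    rw [← Finset.sum_div, Finset.sum_add_distrib, Finset.sum_comm,
      div_eq_one_iff_eq (by positivity)]
    simp

theorem tendsto_occ_sub_average {d m : ℕ} (hd : 0 < d) {Ω : Type*}
    (W : ℕ → Ω → Fin m → Fin d) (ω : Ω) (i : Fin m) (v : Fin d) :
    Tendsto (fun n => occ d m W n ω i v
      - (n : ℝ)⁻¹ * ∑ k ∈ Finset.range n, if W (k + 1) ω i = v then (1 : ℝ) else 0)
      atTop (nhds 0) := by
  have hd' : (0 : ℝ) < d := by exact_mod_cast hd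
  have hlim : Tendsto (fun n : ℕ => (1 + d : ℝ) * (n : ℝ)⁻¹) atTop (nhds 0) := by
    simpa using (tendsto_inv_atTop_nhds_zero_nat (𝕜 := ℝ)).const_mul (1 + d : ℝ)
  refine squeeze_zero_norm' ?_ hlim
  filter_upwards [eventually_ge_atTop 1] with n hn
  have hn0 : (0 : ℝ) < n := by exact_mod_cast hn
  simp only [occ]
  rw [← Finset.Ico_add_one_right_eq_Icc, Finset.sum_Ico_eq_sum_range]
  simp only [add_tsub_cancel_right, add_comm 1]
  set s := ∑ k ∈ Finset.range n, if W (k + 1) ω i = v then (1 : ℝ) else 0 with hs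
  have hs0 : 0 ≤ s := Finset.sum_nonneg fun k _ => by split_ifs <;> norm_num
  have hsn : s ≤ n := by
    refine (Finset.sum_le_sum fun k _ =>
      (by split_ifs <;> norm_num : (if W (k + 1) ω i = v then (1 : ℝ) else 0) ≤ 1)).trans ?_
    simp
  have heq : (1 + s) / (d + n) - (n : ℝ)⁻¹ * s = (n - d * s) / ((d + n) * n) := by
    field_simp
    ring
  rw [heq, Real.norm_eq_abs, abs_div, abs_of_pos (by positivity : (0 : ℝ) < (d + n) * n),
    ← div_eq_mul_inv, div_le_div_iff₀ (by positivity) hn0]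
  have habs : |(n : ℝ) - d * s| ≤ (1 + d) * n := by
    rw [abs_le]
    constructor <;> nlinarith
  calc |(n : ℝ) - d * s| * n ≤ ((1 + d) * n) * n := by gcongr
    _ ≤ (1 + d) * ((d + n) * n) := by nlinarith [mul_pos hd' hn0, mul_pos (mul_pos hd' hn0) hd']

theorem piMap_mem_Icc {d m : ℕ} (α : Fin d → Fin m → Fin m → ℝ) (x : Fin m → Fin d → ℝ)
    (i : Fin m) (v : Fin d) : piMap d m α x i v ∈ Set.Icc (0 : ℝ) 1 := by
  have hpos : ∀ u, 0 ≤ Real.exp (∑ j, α u i j * x j u) := fun u => (Real.exp_pos _).le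
  exact ⟨div_nonneg (hpos v) (Finset.sum_nonneg fun u _ => hpos u),
    div_le_one_of_le₀ (Finset.single_le_sum (fun u _ => hpos u) (Finset.mem_univ v))
      (Finset.sum_nonneg fun u _ => hpos u)⟩

theorem measurable_piMap_occ {d m : ℕ} (α : Fin d → Fin m → Fin m → ℝ) {Ω : Type*}
    {mΩ : MeasurableSpace Ω} (W : ℕ → Ω → Fin m → Fin d) (n : ℕ)
    (hW : ∀ k ∈ Finset.Icc 1 n, Measurable (W k)) (i : Fin m) (v : Fin d) :
    Measurable fun ω => piMap d m α (occ d m W n ω) i v := by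
  have hocc : ∀ j u, Measurable fun ω => occ d m W n ω j u := fun j u => by
    refine (Measurable.const_add (Finset.measurable_fun_sum _ fun k hk => ?_) 1).div_const _
    exact (measurable_of_finite fun y : Fin m → Fin d => if y j = u then (1 : ℝ) else 0).comp
      (hW k hk)
  have hexp : ∀ u, Measurable fun ω => Real.exp (∑ j, α u i j * occ d m W n ω j u) := fun u =>
    (Finset.measurable_fun_sum _ fun j _ => (hocc j u).const_mul _).exp
  exact (hexp v).div (Finset.measurable_fun_sum _ fun u _ => hexp u)

/-- Weakly interacting case with equal repulsion strengths: if
`α_v^{ij} = -β (1 - δ_{ij})` with `β > 0`, and either (C1) `d = 2` and `β ≤ 2`, or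
(C2) `β < 4 / (d (m - 1))`, then the occupation measure process converges almost surely
to the uniform point `(1/d, …, 1/d)`. -/
theorem as_convergence_uniform_weak_interaction (d m : ℕ) (hd : 2 ≤ d) (hm : 2 ≤ m)
    (β : ℝ) (hβ : 0 < β)
    (α : Fin d → Fin m → Fin m → ℝ)
    (hα : ∀ v i j, α v i j = if i = j then 0 else -β)
    (hcase : (d = 2 ∧ β ≤ 2) ∨ β < 4 / ((d : ℝ) * ((m : ℝ) - 1)))
    {Ω : Type*} [MeasurableSpace Ω] (ℙ : Measure Ω) [IsProbabilityMeasure ℙ]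
    (W : ℕ → Ω → Fin m → Fin d) (hWmeas : ∀ n, Measurable (W n))
    (ℱ : Filtration ℕ ‹MeasurableSpace Ω›)
    (hℱ : ∀ n, ℱ n = ⨆ k ∈ Finset.Icc 1 n, MeasurableSpace.comap (W k) ⊤)
    (hcond : ∀ n (i : Fin m) (v : Fin d),
      (ℙ[fun ω => if W (n + 1) ω i = v then (1 : ℝ) else 0 | ℱ n])
        =ᵐ[ℙ] fun ω => piMap d m α (occ d m W n ω) i v)
    (hindep : ∀ n (v : Fin m → Fin d),
      (ℙ[fun ω => if (∀ i, W (n + 1) ω i = v i) then (1 : ℝ) else 0 | ℱ n])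
        =ᵐ[ℙ] fun ω => ∏ i, piMap d m α (occ d m W n ω) i (v i)) :
    ∀ᵐ ω ∂ℙ,
      Tendsto (fun n => occ d m W n ω) atTop
        (nhds (fun _ _ => 1 / (d : ℝ))) := by
  have hd0 : 0 < d := by omega
  have hWℱ : ∀ n, ∀ k ∈ Finset.Icc 1 n, Measurable[ℱ n] (W k) := by
    intro n k hk
    rw [hℱ n]
    refine Measurable.mono (comap_measurable (W k)) ?_ le_top
    exact le_iSup₂_of_le k hk le_rfl
  have hlln : ∀ᵐ ω ∂ℙ, ∀ i v, Tendsto (fun n : ℕ => (n : ℝ)⁻¹ * ∑ k ∈ Finset.range n,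
      ((if W (k + 1) ω i = v then (1 : ℝ) else 0) - piMap d m α (occ d m W k ω) i v))
      atTop (nhds 0) := by
    rw [ae_all_iff]
    intro i
    rw [ae_all_iff]
    intro v
    have hπ : ∀ k, Measurable[ℱ k] fun ω => piMap d m α (occ d m W k ω) i v := fun k =>
      measurable_piMap_occ α W k (hWℱ k) i v
    have hind : ∀ k, Measurable[ℱ (k + 1)] fun ω => if W (k + 1) ω i = v then (1 : ℝ) else 0 :=
      fun k => (measurable_of_finite fun y : Fin m → Fin d =>
        if y i = v then (1 : ℝ) else 0).comp (hWℱ (k + 1) (k + 1) (by simp))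
    have hindI : ∀ k, Integrable (fun ω => if W (k + 1) ω i = v then (1 : ℝ) else 0) ℙ :=
      fun k => Integrable.of_bound ((hind k).mono (ℱ.le _) le_rfl).aestronglyMeasurable 1
        (Eventually.of_forall fun ω => by split_ifs <;> simp)
    have hπI : ∀ k, Integrable (fun ω => piMap d m α (occ d m W k ω) i v) ℙ :=
      fun k => Integrable.of_bound ((hπ k).mono (ℱ.le _) le_rfl).aestronglyMeasurable 1
        (Eventually.of_forall fun ω => by
          have := piMap_mem_Icc α (occ d m W k ω) i v
          rw [Real.norm_of_nonneg this.1]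
          exact this.2)
    refine ae_tendsto_average_of_bounded_martingale_difference ℙ ℱ
      (fun k ω => (if W (k + 1) ω i = v then (1 : ℝ) else 0)
        - piMap d m α (occ d m W k ω) i v) 1 (fun k => ?_) (fun k ω => ?_) (fun k => ?_)
    · exact ((hind k).sub ((hπ k).mono (ℱ.mono k.le_succ) le_rfl)).stronglyMeasurable
    · have := piMap_mem_Icc α (occ d m W k ω) i v
      rw [abs_le]
      split_ifs <;> constructor <;> linarith [this.1, this.2]
    · have h1 := condExp_sub (hindI k) (hπI k) (ℱ k)
      have h2 := condExp_of_stronglyMeasurable (ℱ.le k) (hπ k).stronglyMeasurable (hπI k)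
      refine h1.trans ?_
      filter_upwards [hcond k i v] with ω hω
      rw [Pi.sub_apply, hω, h2]
      simp
  filter_upwards [hlln] with ω hω
  have hx : ∀ n, occ d m W n ω ∈ simplexD d m := fun n => occ_mem_simplexD hd0 W n ω
  have havg : ∀ i v, Tendsto (fun n => occ d m W n ω i v
      - (n : ℝ)⁻¹ * ∑ k ∈ Finset.range n, piMap d m α (occ d m W k ω) i v)
      atTop (nhds 0) := by
    intro i v
    have h1 := (tendsto_occ_sub_average hd0 W ω i v).add (hω i v)
    rw [add_zero] at h1
    refine h1.congr fun n => ?_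
    rw [Finset.sum_sub_distrib]
    ring
  refine tendsto_uniform_of_tendsto_sub hd0 hx fun i v w hvw => ?_
  rcases hcase with ⟨rfl, hβ2⟩ | hsmall
  · exact tendsto_sub_of_two_vertices hβ (by omega) hβ2 hα hx havg hvw i
  · refine tendsto_sub_of_contracting hβ (by omega) ?_ hα hx havg hvw i
    have hm1 : (0 : ℝ) < (m : ℝ) - 1 := by
      have : (2 : ℝ) ≤ m := by exact_mod_cast hm
      linarith
    have hd2 : (2 : ℝ) ≤ d := by exact_mod_cast hd
    rw [lt_div_iff₀ (by positivity)] at hsmall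
    nlinarith [mul_pos hβ hm1]
end

section
/- Suppose α_v^{ii} = 0 for all v ∈ [d], i ∈ [m], and Σ_{u=1}^d Σ_{j≠i} |α_u^{ij}| < 4 for each i ∈ [m]. Then the map π : 𝔇 → 𝔇 has exactly one fixed point in 𝔇; equivalently, the vector field F(x) = −x + π(x) has exactly one zero in 𝔇. -/
theorem softmax_coeff_le {ι : Type*} [Fintype ι] [DecidableEq ι] (e : ι → ℝ)
    (he : ∀ u, 0 < e u) (v u : ι) :
    e v * |(if u = v then ∑ w, e w else 0) - e u| ≤ (∑ w, e w) ^ 2 / 4 := by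
  have hv : e v ≤ ∑ w, e w :=
    Finset.single_le_sum (fun w _ => (he w).le) (Finset.mem_univ v)
  by_cases h : u = v
  · subst h
    rw [if_pos rfl, abs_of_nonneg (by linarith)]
    nlinarith [sq_nonneg (∑ w, e w - 2 * e u)]
  · have hpair : e u + e v ≤ ∑ w, e w := by
      rw [← Finset.sum_pair h]
      exact Finset.sum_le_sum_of_subset_of_nonneg (Finset.subset_univ _)
        fun w _ _ => (he w).le
    rw [if_neg h, zero_sub, abs_neg, abs_of_pos (he u)]
    nlinarith [sq_nonneg (e u - e v), he u, he v]

theorem hasDerivAt_softmax_line {ι : Type*} [Fintype ι] [Nonempty ι] (a b : ι → ℝ)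
    (v : ι) (t : ℝ) :
    HasDerivAt (fun t : ℝ => Real.exp (a v + t * b v) / ∑ u, Real.exp (a u + t * b u))
      ((Real.exp (a v + t * b v) * b v * (∑ u, Real.exp (a u + t * b u)) -
        Real.exp (a v + t * b v) * ∑ u, Real.exp (a u + t * b u) * b u) /
        (∑ u, Real.exp (a u + t * b u)) ^ 2) t := by
  have hexp : ∀ u, HasDerivAt (fun t : ℝ => Real.exp (a u + t * b u))
      (Real.exp (a u + t * b u) * b u) t := fun u => by
    simpa using (((hasDerivAt_id t).mul_const (b u)).const_add (a u)).exp
  exact (hexp v).div (HasDerivAt.fun_sum fun u _ => hexp u)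
    (Finset.sum_pos (fun u _ => Real.exp_pos _) Finset.univ_nonempty).ne'

theorem abs_softmax_sub_le {ι : Type*} [Fintype ι] [Nonempty ι] (h k : ι → ℝ) (v : ι) :
    |Real.exp (h v) / ∑ u, Real.exp (h u) - Real.exp (k v) / ∑ u, Real.exp (k u)| ≤
      (∑ u, |h u - k u|) / 4 := by
  classical
  set b : ι → ℝ := fun u => h u - k u with hb
  have key := Convex.norm_image_sub_le_of_norm_hasDerivWithin_le
    (C := (∑ u, |b u|) / 4) (s := Set.univ) (x := (0 : ℝ)) (y := 1)
    (fun t _ => (hasDerivAt_softmax_line k b v t).hasDerivWithinAt) ?_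
    convex_univ trivial trivial
  · simpa [hb] using key
  · intro t _
    set e : ι → ℝ := fun u => Real.exp (k u + t * b u)
    have he : ∀ u, 0 < e u := fun u => Real.exp_pos _
    have hS : 0 < ∑ u, e u := Finset.sum_pos (fun u _ => he u) Finset.univ_nonempty
    have hnum : e v * b v * (∑ u, e u) - e v * ∑ u, e u * b u =
        ∑ u, e v * ((if u = v then ∑ w, e w else 0) - e u) * b u := by
      simp only [mul_sub, sub_mul, Finset.sum_sub_distrib, Finset.mul_sum, mul_ite, ite_mul,
        mul_zero, zero_mul, Finset.sum_ite_eq', Finset.mem_univ, if_true]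
      simp only [← Finset.mul_sum, mul_assoc]
      rw [mul_comm (b v)]
    rw [Real.norm_eq_abs, abs_div, abs_of_pos (pow_pos hS 2), div_le_iff₀ (pow_pos hS 2)]
    change |e v * b v * (∑ u, e u) - e v * ∑ u, e u * b u| ≤ _ * (∑ u, e u) ^ 2
    rw [hnum]
    calc _ ≤ ∑ u, |e v * ((if u = v then ∑ w, e w else 0) - e u) * b u| :=
          Finset.abs_sum_le_sum_abs _ _
      _ ≤ ∑ u, (∑ w, e w) ^ 2 / 4 * |b u| := by
          refine Finset.sum_le_sum fun u _ => ?_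
          rw [abs_mul, abs_mul, abs_of_pos (he v)]
          exact mul_le_mul_of_nonneg_right (softmax_coeff_le e he v u) (abs_nonneg _)
      _ = (∑ u, |b u|) / 4 * (∑ u, e u) ^ 2 := by
          rw [← Finset.mul_sum]; ring

theorem piMap_mem_simplexD {d : ℕ} [NeZero d] {m : ℕ} (α : Fin d → Fin m → Fin m → ℝ)
    (x : Fin m → Fin d → ℝ) : piMap d m α x ∈ simplexD d m := by
  intro i
  refine ⟨fun v => ?_, ?_⟩
  · unfold piMap
    positivity
  · simp only [piMap, ← Finset.sum_div]
    exact div_self (Finset.sum_pos (fun u _ => Real.exp_pos _) Finset.univ_nonempty).ne'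

theorem lipschitzWith_piMap {d : ℕ} [NeZero d] {m : ℕ} (α : Fin d → Fin m → Fin m → ℝ)
    (K : NNReal) (hK : ∀ i, (∑ u, ∑ j, |α u i j|) / 4 ≤ K) :
    LipschitzWith K (piMap d m α) := by
  refine LipschitzWith.of_dist_le_mul fun x y => ?_
  have hKd : 0 ≤ (K : ℝ) * dist x y := by positivity
  refine (dist_pi_le_iff hKd).2 fun i => (dist_pi_le_iff hKd).2 fun v => ?_
  rw [Real.dist_eq]
  refine (abs_softmax_sub_le (fun u => ∑ j, α u i j * x j u)
    (fun u => ∑ j, α u i j * y j u) v).trans ?_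
  calc _ ≤ (∑ u, ∑ j, |α u i j| * dist x y) / 4 := by
        gcongr with u
        rw [← Finset.sum_sub_distrib]
        refine (Finset.abs_sum_le_sum_abs _ _).trans (Finset.sum_le_sum fun j _ => ?_)
        rw [← mul_sub, abs_mul, ← Real.dist_eq]
        gcongr
        exact (dist_le_pi_dist (x j) (y j) u).trans (dist_le_pi_dist x y j)
    _ = (∑ u, ∑ j, |α u i j|) / 4 * dist x y := by
        simp only [← Finset.sum_mul]; ring
    _ ≤ K * dist x y := by gcongr; exact hK i

/-- If `α_v^{ii} = 0` for all `v, i` and `Σ_u Σ_{j ≠ i} |α_u^{ij}| < 4` for each `i`,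
then `π` has exactly one fixed point in `𝔇` (equivalently, `F(x) = -x + π(x)` has exactly
one zero in `𝔇`). -/
theorem unique_fixed_point (d m : ℕ) (hd : 2 ≤ d) (hm : 2 ≤ m)
    (α : Fin d → Fin m → Fin m → ℝ) (hsym : ∀ v i j, α v i j = α v j i)
    (hdiag : ∀ v i, α v i i = 0)
    (hC3 : ∀ i : Fin m, ∑ u, ∑ j ∈ Finset.univ.erase i, |α u i j| < 4) :
    ∃! x : Fin m → Fin d → ℝ, x ∈ simplexD d m ∧ piMap d m α x = x := by
  have : NeZero d := ⟨by omega⟩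
  have : NeZero m := ⟨by omega⟩
  have hsum : ∀ i, ∑ u, ∑ j, |α u i j| < 4 := fun i => by
    refine lt_of_eq_of_lt (Finset.sum_congr rfl fun u _ => ?_) (hC3 i)
    exact (Finset.sum_erase _ (by simp [hdiag])).symm
  obtain ⟨i₀, -, hmax⟩ := Finset.exists_max_image Finset.univ
    (fun i => ∑ u, ∑ j, |α u i j|) Finset.univ_nonempty
  let K : NNReal := ⟨(∑ u, ∑ j, |α u i₀ j|) / 4, by positivity⟩
  have hcontr : ContractingWith K (piMap d m α) := by
    refine ⟨?_, lipschitzWith_piMap α K fun i => ?_⟩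
    · rw [← NNReal.coe_lt_coe]
      change (∑ u, ∑ j, |α u i₀ j|) / 4 < 1
      linarith [hsum i₀]
    · change _ ≤ (∑ u, ∑ j, |α u i₀ j|) / 4
      linarith [hmax i (Finset.mem_univ i)]
  have hfix := hcontr.fixedPoint_isFixedPt
  refine ⟨_, ⟨?_, hfix⟩, fun y hy => hcontr.fixedPoint_unique hy.2⟩
  rw [← hfix.eq]
  exact piMap_mem_simplexD α _
end

section
/- Let d = m = 2 and let β ≥ 0, with α_v^{ij} = −β for i ≠ j and α_v^{ii} = 0 (v ∈ {1,2}, i,j ∈ {1,2}). If β ∈ [0, 2), then the vertex occupation measure process X(n) converges almost surely to (1/2, 1/2, 1/2, 1/2). If β > 2, then X(n) converges almost surely to (a, 1−a, 1−a, a) or to (1−a, a, a, 1−a), where a ∈ (0, 1/2) is the unique solution in (0, 1/2) of a = 1/(1 + e^{β(1−2a)}). -/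
open Filter MeasureTheory

/-- A real sequence with vanishing increments which is pushed upwards near `c` ends up
on one side of `c`. -/
theorem eventually_le_or_eventually_ge_of_drift {x r : ℕ → ℝ} {c δ : ℝ} (hδ : 0 < δ)
    (hrec : ∀ n, x (n + 1) = x n + r n) (hr : Tendsto r atTop (nhds 0))
    (hdrift : ∀ᶠ n in atTop, |x n - c| ≤ δ → 0 ≤ r n) :
    (∀ᶠ n in atTop, x n ≤ c) ∨ ∀ᶠ n in atTop, c ≤ x n := by
  by_contra! h
  obtain ⟨h1, h2⟩ := h
  have hsmall : ∀ᶠ n in atTop, |r n| < δ := by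
    have := hr.abs
    rw [abs_zero] at this
    exact this.eventually (gt_mem_nhds hδ)
  obtain ⟨N, hN⟩ := eventually_atTop.1 (hdrift.and hsmall)
  obtain ⟨n, hn, hcn⟩ := (frequently_atTop.1 h1) N
  refine h2 (eventually_atTop.2 ⟨n, fun k hk => not_lt.2 ?_⟩)
  induction k, hk using Nat.le_induction with
  | base => exact hcn.le
  | succ k hk ih =>
    obtain ⟨hd, hs⟩ := hN k (hn.trans hk)
    rw [abs_lt] at hs
    rw [hrec]
    by_cases hc : x k ≤ c + δ
    · have := hd (abs_le.2 ⟨by linarith, by linarith⟩)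
      linarith
    · linarith

/-- If the steps `γ n` have divergent sum, a sequence cannot converge to a point near which its
normalized drift is bounded below by a positive constant. -/
theorem not_tendsto_of_drift {x γ g : ℕ → ℝ} {c δ η : ℝ} (hδ : 0 < δ) (hη : 0 < η)
    (hγ0 : ∀ n, 0 ≤ γ n) (hγ : Tendsto (fun n => ∑ k ∈ Finset.range n, γ k) atTop atTop)
    (hrec : ∀ n, x (n + 1) = x n + γ n * g n)
    (hdrift : ∀ᶠ n in atTop, |x n - c| ≤ δ → η ≤ g n) :
    ¬ Tendsto x atTop (nhds c) := by
  intro hx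
  have hnear : ∀ᶠ n in atTop, |x n - c| ≤ δ := by
    have := (Metric.tendsto_nhds.1 hx) δ hδ
    filter_upwards [this] with n hn
    exact (Real.dist_eq _ _ ▸ hn).le
  obtain ⟨N, hN⟩ := eventually_atTop.1 (hdrift.and hnear)
  have key : ∀ n, N ≤ n →
      x N + η * (∑ k ∈ Finset.range n, γ k - ∑ k ∈ Finset.range N, γ k) ≤ x n := by
    intro n hn
    induction n, hn using Nat.le_induction with
    | base => simp
    | succ n hn ih =>
      have h1 := mul_le_mul_of_nonneg_left ((hN n hn).1 (hN n hn).2) (hγ0 n)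
      rw [Finset.sum_range_succ, hrec]
      nlinarith
  have htop : Tendsto x atTop atTop := by
    refine tendsto_atTop_mono' atTop (eventually_atTop.2 ⟨N, key⟩) ?_
    refine tendsto_atTop_add_const_left _ _ (Tendsto.const_mul_atTop hη ?_)
    exact tendsto_atTop_add_const_right _ _ hγ
  exact not_tendsto_nhds_of_tendsto_atTop htop _ hx

/-- A bounded stochastic-approximation recursion on the line with summable noise converges, as soon
as at every point of a dense set `D` the drift is eventually bounded away from zero with a constant
sign; and the limit is not in `D`. -/
theorem exists_tendsto_of_drift {x γ g ζ : ℕ → ℝ} {D : Set ℝ} {C : ℝ}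
    (hγ0 : ∀ n, 0 ≤ γ n) (hγ1 : Tendsto γ atTop (nhds 0))
    (hγ : Tendsto (fun n => ∑ k ∈ Finset.range n, γ k) atTop atTop)
    (hrec : ∀ n, x (n + 1) = x n + γ n * (g n + ζ n))
    (hζ : ∃ l, Tendsto (fun n => ∑ k ∈ Finset.range n, γ k * ζ k) atTop (nhds l))
    (hx : ∀ n, |x n| ≤ C) (hg : ∀ n, |g n| ≤ C) (hD : Dense D)
    (hdrift : ∀ c ∈ D, ∃ δ > 0, ∃ η > 0, (∀ᶠ n in atTop, |x n - c| ≤ δ → η ≤ g n) ∨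
      ∀ᶠ n in atTop, |x n - c| ≤ δ → g n ≤ -η) :
    ∃ c, c ∉ D ∧ Tendsto x atTop (nhds c) := by
  obtain ⟨l, hl⟩ := hζ
  set R : ℕ → ℝ := fun n => ∑ k ∈ Finset.range n, γ k * ζ k - l with hR
  have hR0 : Tendsto R atTop (nhds 0) := by simpa using hl.sub_const l
  set y : ℕ → ℝ := fun n => x n - R n with hy
  have hyrec : ∀ n, y (n + 1) = y n + γ n * g n := by
    intro n
    simp only [hy, hR, hrec, Finset.sum_range_succ]
    ring
  have hr : Tendsto (fun n => γ n * g n) atTop (nhds 0) := by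
    refine squeeze_zero_norm (a := fun n => γ n * C) (fun n => ?_) (by simpa using hγ1.mul_const C)
    rw [norm_mul, Real.norm_of_nonneg (hγ0 n)]
    exact mul_le_mul_of_nonneg_left (hg n) (hγ0 n)
  have hnear : ∀ δ > 0, ∀ᶠ n in atTop, |R n| ≤ δ := by
    intro δ hδ
    filter_upwards [(Metric.tendsto_nhds.1 hR0) δ hδ] with n hn
    rw [Real.dist_eq, sub_zero] at hn
    exact hn.le
  have hdrift' : ∀ c ∈ D, ∃ δ > 0, ∃ η > 0, (∀ᶠ n in atTop, |y n - c| ≤ δ → η ≤ g n) ∨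
      ∀ᶠ n in atTop, |y n - c| ≤ δ → g n ≤ -η := by
    intro c hc
    obtain ⟨δ, hδ, η, hη, h⟩ := hdrift c hc
    have hxy : ∀ᶠ n in atTop, |y n - c| ≤ δ / 2 → |x n - c| ≤ δ := by
      filter_upwards [hnear (δ / 2) (by positivity)] with n hn h1
      have : x n - c = (y n - c) + R n := by simp only [hy]; ring
      rw [this]
      exact (abs_add_le _ _).trans (by linarith)
    refine ⟨δ / 2, by positivity, η, hη, h.imp (fun h => ?_) fun h => ?_⟩ <;>
    · filter_upwards [h, hxy] with n h1 h2 h3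
      exact h1 (h2 h3)
  have hside : ∀ c ∈ D, (∀ᶠ n in atTop, y n ≤ c) ∨ ∀ᶠ n in atTop, c ≤ y n := by
    intro c hc
    obtain ⟨δ, hδ, η, hη, h | h⟩ := hdrift' c hc
    · refine eventually_le_or_eventually_ge_of_drift hδ hyrec hr ?_
      filter_upwards [h] with n hn h1
      exact mul_nonneg (hγ0 n) (hη.le.trans (hn h1))
    · have := eventually_le_or_eventually_ge_of_drift (x := fun n => - y n)
        (r := fun n => - (γ n * g n)) (c := -c) hδ (fun n => by rw [hyrec]; ring)
        (by simpa using hr.neg) (by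
          filter_upwards [h] with n hn h1
          have h2 : |y n - c| ≤ δ := by rwa [← abs_neg, show -(y n - c) = -y n - -c by ring]
          nlinarith [hn h2, hγ0 n])
      simpa only [neg_le_neg_iff, or_comm] using this
  have hyb : ∀ᶠ n in atTop, |y n| ≤ C + 1 := by
    filter_upwards [hnear 1 one_pos] with n hn
    exact (abs_sub _ _).trans (add_le_add (hx n) hn)
  obtain ⟨c, hc⟩ : ∃ c, Tendsto y atTop (nhds c) := by
    refine tendsto_of_no_upcrossings hD ?_ ?_ ?_
    · rintro a ha b hb hab ⟨h1, h2⟩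
      rcases hside a ha with h | h
      · refine h2 ?_
        filter_upwards [h] with n hn
        exact not_lt.2 (hn.trans hab.le)
      · refine h1 ?_
        filter_upwards [h] with n hn
        exact not_lt.2 hn
    · exact isBoundedUnder_of_eventually_le (hyb.mono fun n hn => (abs_le.1 hn).2)
    · exact isBoundedUnder_of_eventually_ge (hyb.mono fun n hn => (abs_le.1 hn).1)
  refine ⟨c, fun hcD => ?_, by simpa [hy] using hc.add hR0⟩
  obtain ⟨δ, hδ, η, hη, h | h⟩ := hdrift' c hcD
  · exact not_tendsto_of_drift hδ hη hγ0 hγ hyrec h hc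
  · refine not_tendsto_of_drift (x := fun n => - y n) (g := fun n => - g n) (c := -c) hδ hη hγ0 hγ
      (fun n => by rw [hyrec]; ring) ?_ hc.neg
    filter_upwards [h] with n hn h1
    have h2 : |y n - c| ≤ δ := by rwa [← abs_neg, show -(y n - c) = -y n - -c by ring]
    linarith [hn h2]

/-- The function `x ↦ tanh (β x / 2)`. -/
noncomputable def halfTanh (β x : ℝ) : ℝ := 1 - 2 / (1 + Real.exp (β * x))

theorem halfTanh_neg (β x : ℝ) : halfTanh β (-x) = -halfTanh β x := by
  unfold halfTanh
  have h := Real.exp_pos (β * x)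
  rw [mul_neg, Real.exp_neg]
  field_simp
  ring

theorem halfTanh_zero (β : ℝ) : halfTanh β 0 = 0 := by
  norm_num [halfTanh]

theorem halfTanh_lt_one (β x : ℝ) : halfTanh β x < 1 := by
  have h : 0 < 2 / (1 + Real.exp (β * x)) := by positivity
  unfold halfTanh
  linarith

theorem neg_one_lt_halfTanh (β x : ℝ) : -1 < halfTanh β x := by
  have := halfTanh_lt_one β (-x)
  rw [halfTanh_neg] at this
  linarith

theorem abs_halfTanh_le_one (β x : ℝ) : |halfTanh β x| ≤ 1 :=
  abs_le.2 ⟨(neg_one_lt_halfTanh β x).le, (halfTanh_lt_one β x).le⟩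

theorem hasDerivAt_halfTanh (β x : ℝ) :
    HasDerivAt (halfTanh β) (β * (1 - halfTanh β x ^ 2) / 2) x := by
  have h1 : HasDerivAt (fun x => Real.exp (β * x)) (Real.exp (β * x) * (β * 1)) x :=
    ((hasDerivAt_id x).const_mul β).exp
  have h2 := (((hasDerivAt_const x (2 : ℝ)).div (h1.const_add 1) (by positivity)).const_sub 1)
  refine h2.congr_deriv ?_
  unfold halfTanh
  have := Real.exp_pos (β * x)
  field_simp
  ring

theorem continuous_halfTanh (β : ℝ) : Continuous (halfTanh β) :=
  continuous_iff_continuousAt.2 fun x => (hasDerivAt_halfTanh β x).continuousAt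

theorem monotone_halfTanh {β : ℝ} (hβ : 0 ≤ β) : Monotone (halfTanh β) := by
  refine monotone_of_deriv_nonneg (fun x => (hasDerivAt_halfTanh β x).differentiableAt) fun x => ?_
  rw [(hasDerivAt_halfTanh β x).deriv]
  nlinarith [abs_le_one_iff_mul_self_le_one.1 (abs_halfTanh_le_one β x)]

theorem abs_halfTanh_sub_le {β : ℝ} (hβ : 0 ≤ β) (x y : ℝ) :
    |halfTanh β x - halfTanh β y| ≤ β / 2 * |x - y| := by
  refine convex_univ.norm_image_sub_le_of_norm_hasDerivWithin_le
    (fun x _ => (hasDerivAt_halfTanh β x).hasDerivWithinAt) (fun x _ => ?_) (Set.mem_univ y)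
    (Set.mem_univ x)
  have := abs_le_one_iff_mul_self_le_one.1 (abs_halfTanh_le_one β x)
  rw [Real.norm_of_nonneg (by nlinarith)]
  nlinarith [mul_self_nonneg (halfTanh β x)]

theorem abs_halfTanh_le {β : ℝ} (hβ : 0 ≤ β) (x : ℝ) : |halfTanh β x| ≤ β / 2 * |x| := by
  simpa [halfTanh_zero] using abs_halfTanh_sub_le hβ x 0

theorem halfTanh_eq_self_of_lt_two {β : ℝ} (hβ : 0 ≤ β) (h2 : β < 2) {x : ℝ}
    (hx : halfTanh β x = x) : x = 0 := by
  have := abs_halfTanh_le hβ x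
  rw [hx] at this
  by_contra h
  nlinarith [abs_pos.2 h]

/-- For `β > 2` the map `halfTanh β` is expanding near the origin. -/
theorem exists_sub_le_halfTanh_sub {β : ℝ} (h2 : 2 < β) :
    ∃ r > 0, ∀ x y, |x| ≤ r → |y| ≤ r → x ≤ y → y - x ≤ halfTanh β y - halfTanh β x := by
  have hc : Continuous fun x => β * (1 - halfTanh β x ^ 2) / 2 := by
    have := continuous_halfTanh β
    fun_prop
  have h0 : ∀ᶠ x in nhds (0 : ℝ), 1 < β * (1 - halfTanh β x ^ 2) / 2 := by
    refine hc.continuousAt.eventually (lt_mem_nhds ?_)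
    simp only [halfTanh_zero]
    linarith
  obtain ⟨r, hr, h⟩ := Metric.nhds_basis_closedBall.eventually_iff.1 h0
  refine ⟨r, hr, fun x y hx hy hxy => ?_⟩
  have hmono : MonotoneOn (fun x => halfTanh β x - x) (Set.Icc (-r) r) := by
    refine monotoneOn_of_hasDerivWithinAt_nonneg (convex_Icc _ _)
      ((continuous_halfTanh β).sub continuous_id).continuousOn
      (fun x _ => ((hasDerivAt_halfTanh β x).sub (hasDerivAt_id x)).hasDerivWithinAt)
      fun x hx => ?_
    rw [interior_Icc] at hx
    have hxr : x ∈ Metric.closedBall 0 r := by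
      rw [Metric.mem_closedBall, Real.dist_eq, sub_zero]
      exact abs_le.2 ⟨hx.1.le, hx.2.le⟩
    have := h hxr
    linarith
  have := hmono (abs_le.1 hx) (abs_le.1 hy) hxy
  simp only at this
  linarith

/-- For `β > 2` the map `halfTanh β` has exactly three fixed points. -/
theorem exists_halfTanh_eq_self {β : ℝ} (h2 : 2 < β) :
    ∃ b ∈ Set.Ioo (0 : ℝ) 1, halfTanh β b = b ∧ ∀ x, 0 < x → halfTanh β x = x → x = b := by
  have hexists : ∃ b ∈ Set.Ioo (0 : ℝ) 1, halfTanh β b = b := by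
    have hd : HasDerivAt (fun x => halfTanh β x - x) (β / 2 - 1) 0 := by
      refine ((hasDerivAt_halfTanh β 0).sub (hasDerivAt_id 0)).congr_deriv ?_
      simp [halfTanh_zero]
    obtain ⟨x, hx0, hx1, hx⟩ : ∃ x, 0 < x ∧ x < 1 ∧ x < halfTanh β x := by
      have h1 := (hasDerivAt_iff_tendsto_slope.1 hd).eventually
        (lt_mem_nhds (show (0 : ℝ) < β / 2 - 1 by linarith))
      have h3 : ∀ᶠ x in nhdsWithin (0 : ℝ) (Set.Ioi 0), x ∈ Set.Ioo (0 : ℝ) 1 :=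
        Ioo_mem_nhdsGT one_pos
      obtain ⟨x, h, hx⟩ := ((h1.filter_mono
        (nhdsWithin_mono 0 fun x (hx : x ∈ Set.Ioi 0) => ne_of_gt hx)).and h3).exists
      refine ⟨x, hx.1, hx.2, ?_⟩
      rw [slope_def_field, halfTanh_zero, sub_zero, sub_zero, sub_zero] at h
      have := (div_pos_iff_of_pos_right hx.1).1 h
      linarith
    obtain ⟨b, hb, hb0⟩ := intermediate_value_Icc' (f := fun x => halfTanh β x - x) hx1.le
      (((continuous_halfTanh β).sub continuous_id).continuousOn)
      (show (0 : ℝ) ∈ _ from ⟨by linarith [halfTanh_lt_one β 1], by linarith⟩)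
    have hb0 : halfTanh β b = b := by simpa [sub_eq_zero] using hb0
    exact ⟨b, ⟨hx0.trans_le hb.1, hb0 ▸ halfTanh_lt_one β b⟩, hb0⟩
  have hconc : StrictConcaveOn ℝ (Set.Ici (0 : ℝ)) (halfTanh β) := by
    have hβ : 0 < β := by linarith
    refine StrictAntiOn.strictConcaveOn_of_deriv (convex_Ici 0)
      (continuous_halfTanh β).continuousOn ?_
    rw [interior_Ici]
    intro x hx y hy hxy
    rw [(hasDerivAt_halfTanh β x).deriv, (hasDerivAt_halfTanh β y).deriv]
    have h0 : 0 ≤ halfTanh β x := by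
      rw [← halfTanh_zero β]; exact monotone_halfTanh hβ.le (le_of_lt hx)
    have hlt : halfTanh β x < halfTanh β y := by
      unfold halfTanh
      gcongr
    have : halfTanh β x ^ 2 < halfTanh β y ^ 2 := by gcongr
    nlinarith
  have huniq : ∀ x y, 0 < x → x < y → halfTanh β x = x → halfTanh β y = y → False := by
    intro x y hx hxy hfx hfy
    have := hconc.slope_anti_adjacent (x := 0) (y := x) (z := y) (by simp)
      (hx.trans hxy).le hx hxy
    rw [hfx, hfy, halfTanh_zero, div_self (by linarith), sub_zero, div_self hx.ne'] at this
    exact lt_irrefl _ this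
  obtain ⟨b, hb, hfb⟩ := hexists
  refine ⟨b, hb, hfb, fun x hx hfx => ?_⟩
  rcases lt_trichotomy x b with h | h | h
  · exact (huniq x b hx h hfx hfb).elim
  · exact h
  · exact (huniq b x hb.1 h hfb hfx).elim

theorem half_one_sub_eq_iff_halfTanh_eq_self (β a : ℝ) :
    a = 1 / (1 + Real.exp (β * (1 - 2 * a))) ↔ halfTanh β (1 - 2 * a) = 1 - 2 * a := by
  unfold halfTanh
  rw [show (2 : ℝ) / (1 + Real.exp (β * (1 - 2 * a))) =
    2 * (1 / (1 + Real.exp (β * (1 - 2 * a)))) by ring]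
  constructor <;> intro h <;> linarith

section MartingaleTransform

variable {Ω : Type*} {m m0 : MeasurableSpace Ω} {μ : Measure Ω}

theorem integrable_of_abs_le [IsFiniteMeasure μ] {f : Ω → ℝ} {C : ℝ} (hf : Measurable f)
    (hC : ∀ ω, |f ω| ≤ C) : Integrable f μ :=
  Integrable.of_bound hf.aestronglyMeasurable C (ae_of_all _ hC)

theorem setIntegral_mul_eq_zero_of_condExp_eq_zero [IsFiniteMeasure μ] (hm : m ≤ m0)
    {Y ζ : Ω → ℝ} {A : Set Ω} {B C : ℝ} (hA : MeasurableSet[m] A) (hY : Measurable[m] Y)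
    (hYB : ∀ ω, |Y ω| ≤ B) (hζ : Measurable ζ) (hζC : ∀ ω, |ζ ω| ≤ C)
    (hmean : μ[ζ | m] =ᵐ[μ] 0) : ∫ ω in A, Y ω * ζ ω ∂μ = 0 := by
  have hζi : Integrable ζ μ := integrable_of_abs_le hζ hζC
  have hi : Integrable (Y * ζ) μ :=
    hζi.bdd_mul (hY.mono hm le_rfl).aestronglyMeasurable (ae_of_all _ hYB)
  have h := setIntegral_condExp hm hi hA
  have h0 : μ[Y * ζ | m] =ᵐ[μ] 0 := by
    filter_upwards [condExp_mul_of_stronglyMeasurable_left hY.stronglyMeasurable hi hζi, hmean]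
      with ω h1 h2
    rw [h1, Pi.mul_apply, h2, Pi.zero_apply, mul_zero]
  rw [setIntegral_congr_ae (g := fun _ => 0) (hm A hA) (h0.mono fun ω h _ => h),
    integral_zero] at h
  exact h.symm

theorem mul_setIntegral_le_of_le_condExp [IsFiniteMeasure μ] (hm : m ≤ m0)
    {Y ξ : Ω → ℝ} {A : Set Ω} {B C σ : ℝ} (hA : MeasurableSet[m] A) (hY : Measurable[m] Y)
    (hY0 : ∀ ω, 0 ≤ Y ω) (hYB : ∀ ω, |Y ω| ≤ B) (hξ : Measurable ξ) (hξC : ∀ ω, |ξ ω| ≤ C)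
    (hvar : ∀ᵐ ω ∂μ, σ ≤ (μ[ξ | m]) ω) :
    σ * ∫ ω in A, Y ω ∂μ ≤ ∫ ω in A, Y ω * ξ ω ∂μ := by
  have hξi : Integrable ξ μ := integrable_of_abs_le hξ hξC
  have hYi : Integrable Y μ := integrable_of_abs_le (hY.mono hm le_rfl) hYB
  have hi : Integrable (Y * ξ) μ :=
    hξi.bdd_mul (hY.mono hm le_rfl).aestronglyMeasurable (ae_of_all _ hYB)
  have h := setIntegral_condExp hm hi hA
  simp only [Pi.mul_apply] at h
  rw [← h, ← integral_const_mul]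
  refine setIntegral_mono_ae (hYi.const_mul σ).integrableOn integrable_condExp.integrableOn ?_
  filter_upwards [condExp_mul_of_stronglyMeasurable_left hY.stronglyMeasurable hi hξi, hvar]
    with ω h1 h2
  rw [h1, Pi.mul_apply, mul_comm σ]
  exact mul_le_mul_of_nonneg_left h2 (hY0 ω)

/-- Moment bounds for one step `V ↦ V + a ζ` of a martingale transform. -/
theorem setIntegral_add_mul_bounds [IsFiniteMeasure μ] (hm : m ≤ m0)
    {V a ζ : Ω → ℝ} {A : Set Ω} {B b c σ : ℝ} (hA : MeasurableSet[m] A) (hσ : 0 ≤ σ)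
    (hV : Measurable[m] V) (hVB : ∀ ω, |V ω| ≤ B) (ha : Measurable[m] a) (hb : 0 ≤ b)
    (hba : ∀ ω, b ≤ a ω) (hac : ∀ ω, a ω ≤ c) (hζ : Measurable ζ) (hζ2 : ∀ ω, |ζ ω| ≤ 2)
    (hmean : μ[ζ | m] =ᵐ[μ] 0) (hvar : ∀ᵐ ω ∂μ, σ ≤ (μ[fun ω => ζ ω ^ 2 | m]) ω) :
    ∫ ω in A, (V ω + a ω * ζ ω) ^ 2 ∂μ ≤ ∫ ω in A, V ω ^ 2 ∂μ + 4 * c ^ 2 * μ.real A ∧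
    ∫ ω in A, V ω ^ 2 ∂μ + σ * (b ^ 2 * μ.real A) ≤ ∫ ω in A, (V ω + a ω * ζ ω) ^ 2 ∂μ ∧
    ∫ ω in A, (V ω + a ω * ζ ω) ^ 4 ∂μ ≤
      ∫ ω in A, V ω ^ 4 ∂μ + 32 * c ^ 2 * ∫ ω in A, V ω ^ 2 ∂μ + 48 * c ^ 4 * μ.real A := by
  have hV' : Measurable V := hV.mono hm le_rfl
  have ha' : Measurable a := ha.mono hm le_rfl
  have ha0 : ∀ ω, 0 ≤ a ω := fun ω => hb.trans (hba ω)
  have hζsq : ∀ ω, ζ ω ^ 2 ≤ 4 := fun ω => by nlinarith [abs_le.1 (hζ2 ω)]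
  have hasq : ∀ ω, a ω ^ 2 ≤ c ^ 2 := fun ω => pow_le_pow_left₀ (ha0 ω) (hac ω) 2
  have hDsq : ∀ ω, (a ω * ζ ω) ^ 2 ≤ 4 * c ^ 2 := fun ω => by
    rw [mul_pow]
    nlinarith [hasq ω, hζsq ω, sq_nonneg (a ω), sq_nonneg (ζ ω)]
  have hVi : ∀ k : ℕ, Integrable (fun ω => V ω ^ k) (μ.restrict A) := fun k =>
    integrable_of_abs_le (C := B ^ k) (hV'.pow_const k) fun ω => by
      rw [abs_pow]
      exact pow_le_pow_left₀ (abs_nonneg _) (hVB ω) k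
  have habs : ∀ ω, |a ω| ≤ c := fun ω => by rw [abs_of_nonneg (ha0 ω)]; exact hac ω
  have hsum : ∀ ω, |V ω + a ω * ζ ω| ≤ B + c * 2 := fun ω => by
    refine (abs_add_le _ _).trans (add_le_add (hVB ω) ?_)
    rw [abs_mul]
    exact mul_le_mul (habs ω) (hζ2 ω) (abs_nonneg _) ((abs_nonneg _).trans (habs ω))
  have hSi : ∀ k : ℕ, Integrable (fun ω => (V ω + a ω * ζ ω) ^ k) (μ.restrict A) := fun k =>
    integrable_of_abs_le (C := (B + c * 2) ^ k) ((hV'.add (ha'.mul hζ)).pow_const k) fun ω => by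
      rw [abs_pow]
      exact pow_le_pow_left₀ (abs_nonneg _) (hsum ω) k
  have hci : ∀ x : ℝ, Integrable (fun _ : Ω => x) (μ.restrict A) := fun x => integrable_const x
  have hmix : ∀ k : ℕ, Integrable (fun ω => V ω ^ k * a ω * ζ ω) (μ.restrict A) ∧
      ∫ ω in A, V ω ^ k * a ω * ζ ω ∂μ = 0 := by
    intro k
    have hbd : ∀ ω, |V ω ^ k * a ω| ≤ B ^ k * c := fun ω => by
      rw [abs_mul, abs_pow]
      exact mul_le_mul (pow_le_pow_left₀ (abs_nonneg _) (hVB ω) k) (habs ω) (abs_nonneg _)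
        (pow_nonneg ((abs_nonneg _).trans (hVB ω)) k)
    refine ⟨integrable_of_abs_le (C := B ^ k * c * 2) (((hV'.pow_const k).mul ha').mul hζ) ?_,
      setIntegral_mul_eq_zero_of_condExp_eq_zero hm hA ((hV.pow_const k).mul ha) hbd hζ hζ2 hmean⟩
    intro ω
    rw [abs_mul]
    exact mul_le_mul (hbd ω) (hζ2 ω) (abs_nonneg _) ((abs_nonneg _).trans (hbd ω))
  have hquad : Integrable (fun ω => a ω ^ 2 * ζ ω ^ 2) (μ.restrict A) :=
    integrable_of_abs_le (C := 4 * c ^ 2) ((ha'.pow_const 2).mul (hζ.pow_const 2)) fun ω => by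
      rw [← mul_pow, abs_of_nonneg (sq_nonneg _)]
      exact hDsq ω
  have hsq : ∫ ω in A, (V ω + a ω * ζ ω) ^ 2 ∂μ =
      ∫ ω in A, V ω ^ 2 ∂μ + ∫ ω in A, a ω ^ 2 * ζ ω ^ 2 ∂μ := by
    have : ∀ ω, (V ω + a ω * ζ ω) ^ 2 =
        (V ω ^ 2 + 2 * (V ω ^ 1 * a ω * ζ ω)) + a ω ^ 2 * ζ ω ^ 2 := fun ω => by ring
    simp_rw [this]
    have h1 : Integrable (fun ω => V ω ^ 2 + 2 * (V ω ^ 1 * a ω * ζ ω)) (μ.restrict A) :=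
      (hVi 2).add ((hmix 1).1.const_mul 2)
    rw [integral_add h1 hquad,
      integral_add (hVi 2) ((hmix 1).1.const_mul 2), integral_const_mul, (hmix 1).2]
    ring
  have hconst : ∀ x : ℝ, ∫ _ in A, x ∂μ = x * μ.real A := fun x => by
    rw [setIntegral_const, smul_eq_mul, mul_comm]
  refine ⟨?_, ?_, ?_⟩
  · rw [hsq, ← hconst]
    refine add_le_add_right (integral_mono hquad (hci _) fun ω => ?_) _
    simp only [← mul_pow]
    exact hDsq ω
  · rw [hsq]
    gcongr
    have h1 := mul_setIntegral_le_of_le_condExp (B := c ^ 2) (C := 4) hm hA (ha.pow_const 2)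
      (fun ω => sq_nonneg _) (fun ω => by rw [abs_of_nonneg (sq_nonneg _)]; exact hasq ω)
      (hζ.pow_const 2) (fun ω => by rw [abs_of_nonneg (sq_nonneg _)]; exact hζsq ω) hvar
    refine le_trans (mul_le_mul_of_nonneg_left ?_ hσ) h1
    rw [← hconst]
    refine integral_mono (hci _) ?_ fun ω => pow_le_pow_left₀ hb (hba ω) 2
    exact integrable_of_abs_le (C := c ^ 2) (ha'.pow_const 2) fun ω => by
      rw [abs_of_nonneg (sq_nonneg _)]; exact hasq ω
  · have hle : ∀ ω, (V ω + a ω * ζ ω) ^ 4 ≤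
        V ω ^ 4 + 4 * (V ω ^ 3 * a ω * ζ ω) + 32 * c ^ 2 * V ω ^ 2 + 48 * c ^ 4 := fun ω => by
      have h1 := hDsq ω
      set D := a ω * ζ ω with hD
      have h2 : V ω ^ 3 * a ω * ζ ω = V ω ^ 3 * D := by rw [hD]; ring
      rw [h2]
      have h3 : 4 * V ω * D ^ 3 ≤ 2 * V ω ^ 2 * D ^ 2 + 2 * D ^ 4 := by
        nlinarith [mul_nonneg (sq_nonneg D) (sq_nonneg (V ω - D))]
      have h4 : D ^ 4 ≤ 16 * c ^ 4 := by nlinarith [sq_nonneg D]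
      have h5 : V ω ^ 2 * D ^ 2 ≤ V ω ^ 2 * (4 * c ^ 2) :=
        mul_le_mul_of_nonneg_left h1 (sq_nonneg _)
      nlinarith
    have h1 : Integrable (fun ω => V ω ^ 4 + 4 * (V ω ^ 3 * a ω * ζ ω)) (μ.restrict A) :=
      (hVi 4).add ((hmix 3).1.const_mul 4)
    have h2 : Integrable (fun ω => V ω ^ 4 + 4 * (V ω ^ 3 * a ω * ζ ω) + 32 * c ^ 2 * V ω ^ 2)
        (μ.restrict A) := h1.add ((hVi 2).const_mul (32 * c ^ 2))
    refine (integral_mono (hSi 4) (h2.add (hci (48 * c ^ 4))) hle).trans_eq ?_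
    rw [integral_add' h2 (hci _), integral_add h1 ((hVi 2).const_mul _),
      integral_add (hVi 4) ((hmix 3).1.const_mul 4), integral_const_mul, integral_const_mul,
      (hmix 3).2, hconst]
    ring

/-- Moment bounds for the martingale transform `Z + ∑ a k * ζ k`. -/
theorem setIntegral_sum_mul_bounds [IsFiniteMeasure μ] {𝒢 : Filtration ℕ m0}
    {Z : Ω → ℝ} {a ζ : ℕ → Ω → ℝ} {A : Set Ω} {B s σ : ℝ} {b c : ℕ → ℝ}
    (hA : MeasurableSet[𝒢 0] A) (hσ : 0 ≤ σ) (hZ : Measurable[𝒢 0] Z) (hZB : ∀ ω, |Z ω| ≤ B)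
    (ha : ∀ n, Measurable[𝒢 n] (a n)) (hb : ∀ n, 0 ≤ b n) (hba : ∀ n ω, b n ≤ a n ω)
    (hac : ∀ n ω, a n ω ≤ c n) (hζ : ∀ n, Measurable[𝒢 (n + 1)] (ζ n))
    (hζ2 : ∀ n ω, |ζ n ω| ≤ 2) (hmean : ∀ n, μ[ζ n | 𝒢 n] =ᵐ[μ] 0)
    (hvar : ∀ n, ∀ᵐ ω ∂μ, σ ≤ (μ[fun ω => ζ n ω ^ 2 | 𝒢 n]) ω)
    (hs : ∀ l, ∑ k ∈ Finset.range l, c k ^ 2 ≤ s) (l : ℕ) :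
    ∫ ω in A, (Z ω + ∑ k ∈ Finset.range l, a k ω * ζ k ω) ^ 2 ∂μ ≤
      ∫ ω in A, Z ω ^ 2 ∂μ + 4 * s * μ.real A ∧
    σ * (∑ k ∈ Finset.range l, b k ^ 2) * μ.real A ≤
      ∫ ω in A, (Z ω + ∑ k ∈ Finset.range l, a k ω * ζ k ω) ^ 2 ∂μ ∧
    ∫ ω in A, (Z ω + ∑ k ∈ Finset.range l, a k ω * ζ k ω) ^ 4 ∂μ ≤
      ∫ ω in A, Z ω ^ 4 ∂μ +
        s * (32 * (∫ ω in A, Z ω ^ 2 ∂μ + 4 * s * μ.real A) + 48 * s * μ.real A) := by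
  set V : ℕ → Ω → ℝ := fun l ω => Z ω + ∑ k ∈ Finset.range l, a k ω * ζ k ω with hVdef
  have hVsucc : ∀ l ω, V (l + 1) ω = V l ω + a l ω * ζ l ω := fun l ω => by
    simp only [hVdef, Finset.sum_range_succ, add_assoc]
  have hVm : ∀ l, Measurable[𝒢 l] (V l) := by
    intro l
    refine (hZ.mono (𝒢.mono (Nat.zero_le l)) le_rfl).add ?_
    refine Finset.measurable_fun_sum _ fun k hk => ?_
    have hk := Finset.mem_range.1 hk
    exact ((ha k).mono (𝒢.mono hk.le) le_rfl).mul ((hζ k).mono (𝒢.mono hk) le_rfl)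
  have hc0 : ∀ n ω, |a n ω| ≤ c n := fun n ω => by
    rw [abs_of_nonneg ((hb n).trans (hba n ω))]
    exact hac n ω
  have hVb : ∀ l ω, |V l ω| ≤ B + ∑ k ∈ Finset.range l, c k * 2 := by
    intro l ω
    refine (abs_add_le _ _).trans (add_le_add (hZB ω) ?_)
    refine (Finset.abs_sum_le_sum_abs _ _).trans (Finset.sum_le_sum fun k _ => ?_)
    rw [abs_mul]
    exact mul_le_mul (hc0 k ω) (hζ2 k ω) (abs_nonneg _) ((abs_nonneg _).trans (hc0 k ω))
  have hμ : 0 ≤ μ.real A := measureReal_nonneg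
  have hstep : ∀ l, _ := fun l => setIntegral_add_mul_bounds (𝒢.le l)
    (𝒢.mono (Nat.zero_le l) _ hA) hσ (hVm l) (hVb l) (ha l) (hb l) (hba l) (hac l)
    ((hζ l).mono (𝒢.le _) le_rfl) (hζ2 l) (hmean l) (hvar l)
  simp only [← hVsucc] at hstep
  have hup : ∀ l, ∫ ω in A, V l ω ^ 2 ∂μ ≤
      ∫ ω in A, Z ω ^ 2 ∂μ + 4 * (∑ k ∈ Finset.range l, c k ^ 2) * μ.real A := by
    intro l
    induction l with
    | zero => simp [hVdef]
    | succ l ih =>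
      rw [Finset.sum_range_succ]
      linarith [(hstep l).1]
  have hup' : ∀ l, ∫ ω in A, V l ω ^ 2 ∂μ ≤ ∫ ω in A, Z ω ^ 2 ∂μ + 4 * s * μ.real A := fun l =>
    (hup l).trans (by nlinarith [hs l])
  refine ⟨hup' l, ?_, ?_⟩
  · change _ ≤ ∫ ω in A, V l ω ^ 2 ∂μ
    induction l with
    | zero =>
      simp only [Finset.range_zero, Finset.sum_empty, mul_zero, zero_mul]
      exact integral_nonneg fun ω => sq_nonneg _
    | succ l ih =>
      rw [Finset.sum_range_succ]
      linarith [(hstep l).2.1]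
  · set E := 32 * (∫ ω in A, Z ω ^ 2 ∂μ + 4 * s * μ.real A) + 48 * s * μ.real A with hE
    have hZ0 : 0 ≤ ∫ ω in A, Z ω ^ 2 ∂μ := integral_nonneg fun ω => sq_nonneg _
    have hs0 : 0 ≤ s := by simpa using hs 0
    have hE0 : 0 ≤ E := by positivity
    have h4 : ∀ l, ∫ ω in A, V l ω ^ 4 ∂μ ≤
        ∫ ω in A, Z ω ^ 4 ∂μ + (∑ k ∈ Finset.range l, c k ^ 2) * E := by
      intro l
      induction l with
      | zero => simp [hVdef]
      | succ l ih =>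
        have hcs : c l ^ 2 ≤ s := by
          have := hs (l + 1)
          rw [Finset.sum_range_succ] at this
          have h0 : 0 ≤ ∑ k ∈ Finset.range l, c k ^ 2 :=
            Finset.sum_nonneg fun k _ => sq_nonneg _
          linarith
        have h1 := mul_le_mul_of_nonneg_left (hup' l) (sq_nonneg (c l))
        have h2 : c l ^ 4 * μ.real A ≤ c l ^ 2 * (s * μ.real A) := by
          rw [show c l ^ 4 = c l ^ 2 * c l ^ 2 by ring, mul_assoc]
          gcongr
        rw [Finset.sum_range_succ, add_mul]
        refine (hstep l).2.2.trans ?_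
        rw [hE] at ih ⊢
        linarith
    refine (h4 l).trans ?_
    gcongr
    exact hs l

end MartingaleTransform

section Levy

variable {Ω : Type*} {m0 : MeasurableSpace Ω} {μ : Measure Ω}

/-- If `G` is a non-null event of the limit σ-algebra then, at arbitrarily late times `n`, there is
a non-null event known at time `n` given which `G` is conditionally almost certain. -/
theorem exists_conditionally_likely [IsProbabilityMeasure μ] {ℱ : Filtration ℕ m0} {G : Set Ω}
    (hG : MeasurableSet[⨆ n, ℱ n] G) (hG0 : μ G ≠ 0) {ε : ℝ} (hε : 0 < ε) (N : ℕ) :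
    ∃ n ≥ N, ∃ A, MeasurableSet[ℱ n] A ∧ 0 < μ.real A ∧
      ∀ B ⊆ A, MeasurableSet[ℱ n] B → μ.real (B \ G) ≤ ε * μ.real B := by
  have hle : (⨆ n, (ℱ n : MeasurableSpace Ω)) ≤ m0 := iSup_le ℱ.le
  have hGm : MeasurableSet G := hle _ hG
  set g : Ω → ℝ := G.indicator fun _ => 1 with hg
  have hgi : Integrable g μ := (integrable_const 1).indicator hGm
  by_contra! hcon
  have hsmall : ∀ n ≥ N, ∀ᵐ ω ∂μ, (μ[g | ℱ n]) ω ≤ 1 - ε := by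
    intro n hn
    set A : Set Ω := {ω | 1 - ε < (μ[g | ℱ n]) ω} with hA
    have hAm : MeasurableSet[ℱ n] A :=
      measurableSet_lt measurable_const stronglyMeasurable_condExp.measurable
    have hA0 : μ A = 0 := by
      by_contra hpos
      obtain ⟨B, hBA, hB, hlt⟩ := hcon n hn A hAm
        (ENNReal.toReal_pos hpos (measure_ne_top _ _))
      have hBm := ℱ.le n _ hB
      have h1 : (1 - ε) * μ.real B ≤ ∫ ω in B, (μ[g | ℱ n]) ω ∂μ := by
        have : ∫ _ in B, (1 - ε) ∂μ = (1 - ε) * μ.real B := by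
          rw [setIntegral_const, smul_eq_mul, mul_comm]
        rw [← this]
        exact setIntegral_mono_on (integrable_const _) integrable_condExp.integrableOn hBm
          fun ω hω => le_of_lt (hBA hω)
      rw [setIntegral_condExp (ℱ.le n) hgi hB, hg, setIntegral_indicator hGm,
        setIntegral_const, smul_eq_mul, mul_one] at h1
      have h2 := measureReal_inter_add_sdiff (μ := μ) (s := B) hGm
      linarith
    rw [ae_iff]
    simpa only [not_le] using hA0
  have hlim := tendsto_ae_condExp (μ := μ) (ℱ := ℱ) g
  have hcond : μ[g | ⨆ n, (ℱ n : MeasurableSpace Ω)] = g :=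
    condExp_of_stronglyMeasurable hle
      (stronglyMeasurable_const.indicator hG) hgi
  rw [hcond] at hlim
  refine hG0 ?_
  rw [measure_eq_zero_iff_ae_notMem]
  filter_upwards [hlim, ae_all_iff.2 fun n => eventually_imp_distrib_left.2 (hsmall n)]
    with ω h1 h2 hω
  have h3 := le_of_tendsto h1 (eventually_atTop.2 ⟨N, h2⟩)
  rw [hg, Set.indicator_of_mem hω] at h3
  linarith

end Levy

section StepSizes

theorem sum_range_sq_step_le (n l : ℕ) :
    ∑ k ∈ Finset.range l, (1 / (((n + k : ℕ) : ℝ) + 3)) ^ 2 ≤ 2 * (1 / ((n : ℝ) + 3)) := by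
  have h : ∑ k ∈ Finset.range l, (1 / (((n + k : ℕ) : ℝ) + 3)) ^ 2 ≤
      1 / ((n : ℝ) + 2) - 1 / ((n : ℝ) + l + 2) := by
    induction l with
    | zero => simp
    | succ l ih =>
      rw [Finset.sum_range_succ]
      have h1 : (1 / (((n + l : ℕ) : ℝ) + 3)) ^ 2 ≤
          1 / ((n : ℝ) + l + 2) - 1 / ((n : ℝ) + (l + 1 : ℕ) + 2) := by
        push_cast
        rw [div_sub_div _ _ (by positivity) (by positivity), div_pow,
          div_le_div_iff₀ (by positivity) (by positivity)]
        nlinarith [(n.cast_nonneg : (0 : ℝ) ≤ n), (l.cast_nonneg : (0 : ℝ) ≤ l)]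
      linarith
  have h2 : 1 / ((n : ℝ) + 2) ≤ 2 * (1 / ((n : ℝ) + 3)) := by
    rw [mul_one_div, div_le_div_iff₀ (by positivity) (by positivity)]
    linarith [(n.cast_nonneg : (0 : ℝ) ≤ n)]
  have h3 : 0 ≤ 1 / ((n : ℝ) + l + 2) := by positivity
  linarith

theorem tendsto_step : Tendsto (fun n : ℕ => 1 / ((n : ℝ) + 3)) atTop (nhds 0) := by
  simpa using (tendsto_one_div_add_atTop_nhds_zero_nat (𝕜 := ℝ)).comp
    (tendsto_add_atTop_nat 2) |>.congr fun n => by simp only [Function.comp]; push_cast; ring_nf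

theorem tendsto_sum_step :
    Tendsto (fun n => ∑ k ∈ Finset.range n, 1 / ((k : ℝ) + 3)) atTop atTop := by
  have h : ∀ n, ∑ k ∈ Finset.range n, 1 / ((k : ℝ) + 1) ≤
      3 * ∑ k ∈ Finset.range n, 1 / ((k : ℝ) + 3) := by
    intro n
    rw [Finset.mul_sum]
    refine Finset.sum_le_sum fun k _ => ?_
    rw [mul_one_div, div_le_div_iff₀ (by positivity) (by positivity)]
    linarith [(k.cast_nonneg : (0 : ℝ) ≤ k)]
  have := tendsto_atTop_mono h Real.tendsto_sum_range_one_div_nat_succ_atTop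
  exact (tendsto_const_mul_atTop_of_pos (by norm_num)).1 this

end StepSizes

section NonConvergence

variable {Ω : Type*} {m0 : MeasurableSpace Ω} {μ : Measure Ω}

/-- The filtration observed from time `n` on. -/
def shiftedFiltration (ℱ : Filtration ℕ m0) (n : ℕ) : Filtration ℕ m0 where
  seq l := ℱ (n + l)
  mono' _ _ h := ℱ.mono (Nat.add_le_add_left h n)
  le' l := ℱ.le (n + l)

/-- Robbins–Monro noise is almost surely summable. -/
theorem ae_exists_tendsto_sum_step_mul [IsProbabilityMeasure μ] {ℱ : Filtration ℕ m0}
    {ζ : ℕ → Ω → ℝ} (hζ : ∀ n, Measurable[ℱ (n + 1)] (ζ n)) (hζ2 : ∀ n ω, |ζ n ω| ≤ 2)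
    (hmean : ∀ n, μ[ζ n | ℱ n] =ᵐ[μ] 0) :
    ∀ᵐ ω ∂μ, ∃ l, Tendsto
      (fun n => ∑ k ∈ Finset.range n, 1 / ((k : ℝ) + 3) * ζ k ω) atTop (nhds l) := by
  set M : ℕ → Ω → ℝ := fun n ω => ∑ k ∈ Finset.range n, 1 / ((k : ℝ) + 3) * ζ k ω with hM
  have hMm : ∀ n, Measurable[ℱ n] (M n) := fun n =>
    Finset.measurable_fun_sum _ fun k hk =>
      ((hζ k).mono (ℱ.mono (Finset.mem_range.1 hk)) le_rfl).const_mul _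
  have hMi : ∀ n, Integrable (M n) μ := fun n =>
    integrable_finsetSum _ fun k _ =>
      (integrable_of_abs_le ((hζ k).mono (ℱ.le _) le_rfl) (hζ2 k)).const_mul _
  have hmart : Martingale M ℱ μ := by
    refine martingale_of_condExp_sub_eq_zero_nat (fun n => (hMm n).stronglyMeasurable) hMi
      fun n => ?_
    have : M (n + 1) - M n = (1 / ((n : ℝ) + 3)) • ζ n := by
      ext ω
      simp [hM, Finset.sum_range_succ]
    rw [this]
    filter_upwards [condExp_smul (μ := μ) (1 / ((n : ℝ) + 3)) (ζ n) (ℱ n), hmean n] with ω h1 h2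
    rw [h1, Pi.smul_apply, h2, Pi.zero_apply, smul_zero]
  have hsq : ∀ n, ∫ ω, M n ω ^ 2 ∂μ ≤ 8 := by
    intro n
    have h := (setIntegral_sum_mul_bounds (μ := μ) (𝒢 := ℱ) (Z := fun _ => 0)
      (a := fun k _ => 1 / ((k : ℝ) + 3)) (ζ := ζ) (A := Set.univ) (B := 0) (s := 2) (σ := 0)
      (b := fun _ => 0) (c := fun k => 1 / ((k : ℝ) + 3)) MeasurableSet.univ le_rfl
      measurable_const (by simp) (fun _ => measurable_const) (fun _ => le_rfl)
      (fun k _ => by positivity) (fun k _ => le_rfl) hζ hζ2 hmean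
      (fun k => condExp_nonneg (ae_of_all _ fun ω => sq_nonneg _))
      (fun l => by
        have := sum_range_sq_step_le 0 l
        simp only [zero_add, Nat.cast_zero] at this
        linarith) n).1
    simp only [zero_add, setIntegral_univ, probReal_univ] at h
    norm_num at h
    simpa [hM] using h
  have hL1 : ∀ n, eLpNorm (M n) 1 μ ≤ ((9 : NNReal) : ENNReal) := by
    intro n
    have hMb : Integrable (fun ω => M n ω ^ 2) μ := by
      refine integrable_of_abs_le (C := (∑ k ∈ Finset.range n, 1 / ((k : ℝ) + 3) * 2) ^ 2)
        (((hMm n).mono (ℱ.le n) le_rfl).pow_const 2) fun ω => ?_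
      rw [abs_pow]
      refine pow_le_pow_left₀ (abs_nonneg _) ((Finset.abs_sum_le_sum_abs _ _).trans
        (Finset.sum_le_sum fun k _ => ?_)) 2
      rw [abs_mul, abs_of_nonneg (by positivity : (0 : ℝ) ≤ 1 / ((k : ℝ) + 3))]
      exact mul_le_mul_of_nonneg_left (hζ2 k ω) (by positivity)
    have h1 : ∫ ω, ‖M n ω‖ ∂μ ≤ 9 := by
      calc ∫ ω, ‖M n ω‖ ∂μ ≤ ∫ ω, (1 + M n ω ^ 2) ∂μ :=
            integral_mono (hMi n).norm ((integrable_const 1).add hMb) fun ω => by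
              simp only [Real.norm_eq_abs]
              nlinarith [sq_nonneg (|M n ω| - 1), sq_abs (M n ω)]
        _ = 1 + ∫ ω, M n ω ^ 2 ∂μ := by
            rw [integral_add (integrable_const 1) hMb]
            simp
        _ ≤ 9 := by linarith [hsq n]
    rw [eLpNorm_one_eq_lintegral_enorm, ← ofReal_integral_norm_eq_lintegral_enorm (hMi n)]
    exact (ENNReal.ofReal_le_ofReal h1).trans (by norm_num)
  exact hmart.submartingale.exists_ae_tendsto_of_bdd hL1

theorem integrable_sum_mul_pow [IsFiniteMeasure μ] {Z : Ω → ℝ} {a ζ : ℕ → Ω → ℝ} {B : ℝ}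
    {c : ℕ → ℝ} (hZ : Measurable Z) (hZB : ∀ ω, |Z ω| ≤ B) (ha : ∀ n, Measurable (a n))
    (hac : ∀ n ω, |a n ω| ≤ c n) (hζ : ∀ n, Measurable (ζ n)) (hζ2 : ∀ n ω, |ζ n ω| ≤ 2)
    (l p : ℕ) :
    Integrable (fun ω => (Z ω + ∑ k ∈ Finset.range l, a k ω * ζ k ω) ^ p) μ := by
  refine integrable_of_abs_le (C := (B + ∑ k ∈ Finset.range l, c k * 2) ^ p)
    ((hZ.add (Finset.measurable_fun_sum _ fun k _ => (ha k).mul (hζ k))).pow_const p) fun ω => ?_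
  rw [abs_pow]
  refine pow_le_pow_left₀ (abs_nonneg _) ((abs_add_le _ _).trans (add_le_add (hZB ω)
    ((Finset.abs_sum_le_sum_abs _ _).trans (Finset.sum_le_sum fun k _ => ?_)))) p
  rw [abs_mul]
  exact mul_le_mul (hac k ω) (hζ2 k ω) (abs_nonneg _) ((abs_nonneg _).trans (hac k ω))

/-- If `V l → 0` boundedly on `G`, then late second moments of `V` live outside of `G`: a set
given which `G` is conditionally likely cannot support moments of `V` of a fixed order. -/
theorem mul_measureReal_le_of_tendsto_zero [IsFiniteMeasure μ] {V : ℕ → Ω → ℝ} {A G : Set Ω}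
    {e p q L : ℝ} {l₀ : ℕ} (hG : MeasurableSet G) (hL : 0 < L)
    (hV : ∀ l p, Integrable (fun ω => V l ω ^ p) μ)
    (hlim : Tendsto (fun l => ∫ ω in A ∩ G, V l ω ^ 2 ∂μ) atTop (nhds 0))
    (hlow : ∀ l ≥ l₀, p ≤ ∫ ω in A, V l ω ^ 2 ∂μ)
    (hup : ∀ l, ∫ ω in A, V l ω ^ 4 ∂μ ≤ q) (hAG : μ.real (A \ G) ≤ e) :
    p ≤ L * e + q / L := by
  have hbound : ∀ l ≥ l₀, p - (L * e + q / L) ≤ ∫ ω in A ∩ G, V l ω ^ 2 ∂μ := by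
    intro l hl
    have h1 := integral_inter_add_sdiff (μ := μ) (s := A) hG ((hV l 2).integrableOn)
    have h2 : ∫ ω in A \ G, V l ω ^ 2 ∂μ ≤ ∫ ω in A \ G, (L + V l ω ^ 4 / L) ∂μ := by
      refine integral_mono (hV l 2).integrableOn
        ((integrable_const L).add ((hV l 4).integrableOn.div_const L)) fun ω => ?_
      have h3 : L * (L + V l ω ^ 4 / L) = L ^ 2 + V l ω ^ 4 := by field_simp
      have h4 : L * V l ω ^ 2 ≤ L * (L + V l ω ^ 4 / L) := by
        rw [h3]
        nlinarith [sq_nonneg (L - V l ω ^ 2), sq_nonneg (V l ω ^ 2)]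
      exact le_of_mul_le_mul_left h4 hL
    rw [integral_add (integrable_const L) ((hV l 4).integrableOn.div_const L),
      setIntegral_const, integral_div, smul_eq_mul] at h2
    have h5 : ∫ ω in A \ G, V l ω ^ 4 ∂μ ≤ ∫ ω in A, V l ω ^ 4 ∂μ :=
      setIntegral_mono_set (hV l 4).integrableOn (ae_of_all _ fun ω => by positivity)
        (Set.sdiff_subset.eventuallyLE)
    have h6 : (∫ ω in A \ G, V l ω ^ 4 ∂μ) / L ≤ q / L :=
      div_le_div_of_nonneg_right (h5.trans (hup l)) hL.le
    nlinarith [hlow l hl]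
  have := ge_of_tendsto hlim (eventually_atTop.2 ⟨l₀, hbound⟩)
  linarith

/-- A Robbins–Monro recursion with nondegenerate noise whose drift points away from `0` converges
to `0` with probability zero. -/
theorem measure_eq_zero_of_repelling [IsProbabilityMeasure μ] {ℱ : Filtration ℕ m0}
    {z κ ζ : ℕ → Ω → ℝ} {σ K : ℝ} {N : ℕ} {G : Set Ω} (hσ : 0 < σ) (hK : 0 ≤ K)
    (hz : ∀ n, Measurable[ℱ n] (z n)) (hz1 : ∀ n ω, |z n ω| ≤ 1)
    (hκ : ∀ n, Measurable[ℱ n] (κ n)) (hκ0 : ∀ n ω, 0 ≤ κ n ω) (hκK : ∀ n ω, κ n ω ≤ K)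
    (hζ : ∀ n, Measurable[ℱ (n + 1)] (ζ n)) (hζ2 : ∀ n ω, |ζ n ω| ≤ 2)
    (hmean : ∀ n, μ[ζ n | ℱ n] =ᵐ[μ] 0)
    (hvar : ∀ n, ∀ᵐ ω ∂μ, σ ≤ (μ[fun ω => ζ n ω ^ 2 | ℱ n]) ω)
    (hG : MeasurableSet[⨆ n, ℱ n] G)
    (hrec : ∀ ω ∈ G, ∀ n ≥ N,
      z (n + 1) ω = z n ω + 1 / ((n : ℝ) + 3) * (κ n ω * z n ω + ζ n ω))
    (hlim : ∀ ω ∈ G, Tendsto (fun n => z n ω) atTop (nhds 0)) :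
    μ G = 0 := by
  by_contra hG0
  have hGm : MeasurableSet G := (iSup_le ℱ.le : (⨆ n, (ℱ n : MeasurableSpace Ω)) ≤ m0) _ hG
  set c₀ : ℝ := σ * Real.exp (-K) ^ 2 / 4 with hc₀
  have hc₀pos : 0 < c₀ := by positivity
  set L : ℝ := 40000 / c₀ with hL
  have hLpos : 0 < L := by positivity
  set ε : ℝ := min (1 / 2) (c₀ / (4 * L)) with hε
  have hεpos : 0 < ε := lt_min (by norm_num) (by positivity)
  obtain ⟨n, hnN, A, hA, hApos, hAG⟩ := exists_conditionally_likely hG hG0 hεpos N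
  set ρ : ℝ := 1 / ((n : ℝ) + 3) with hρ
  have hρpos : 0 < ρ := by positivity
  set γ : ℕ → ℝ := fun k => 1 / (((n + k : ℕ) : ℝ) + 3) with hγ
  have hγ0 : ∀ k, 0 < γ k := fun k => by positivity
  have hγρ : ∀ k, γ k ≤ ρ := fun k => by
    simp only [hγ, hρ]
    gcongr
    exact Nat.le_add_right n k
  set Q : ℕ → Ω → ℝ := fun l ω => ∏ i ∈ Finset.range l, (1 + γ i * κ (n + i) ω) with hQ
  have hQ1 : ∀ l ω, 1 ≤ Q l ω := fun l ω => by
    refine Finset.one_le_prod fun i _ => ?_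
    change (1 : ℝ) ≤ 1 + γ i * κ (n + i) ω
    have := mul_nonneg (hγ0 i).le (hκ0 (n + i) ω)
    linarith
  have hQ0 : ∀ l ω, 0 < Q l ω := fun l ω => one_pos.trans_le (hQ1 l ω)
  set a : ℕ → Ω → ℝ := fun k ω => γ k / Q (k + 1) ω with ha
  set b : ℕ → ℝ := fun k => if k < n + 3 then ρ / 2 * Real.exp (-K) else 0 with hb
  have hb0 : ∀ k, 0 ≤ b k := fun k => by
    simp only [hb]
    split_ifs <;> positivity
  have ham : ∀ k, Measurable[ℱ (n + k)] (a k) := fun k => by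
    refine measurable_const.div (Finset.measurable_fun_prod _ fun i hi => ?_)
    have hi := Nat.lt_succ_iff.1 (Finset.mem_range.1 hi)
    exact (((hκ (n + i)).mono (ℱ.mono (by omega)) le_rfl).const_mul _).const_add _
  have haγ : ∀ k ω, a k ω ≤ γ k := fun k ω => div_le_self (hγ0 k).le (hQ1 _ ω)
  have hba : ∀ k ω, b k ≤ a k ω := fun k ω => by
    simp only [hb]
    split_ifs with hk
    · have h1 : Q (k + 1) ω ≤ Real.exp K := by
        calc Q (k + 1) ω ≤ ∏ i ∈ Finset.range (k + 1), Real.exp (ρ * K) := by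
              refine Finset.prod_le_prod (fun i _ => ?_) fun i _ => ?_
              · have := mul_nonneg (hγ0 i).le (hκ0 (n + i) ω)
                linarith
              · refine le_trans ?_ (Real.add_one_le_exp _)
                rw [add_comm]
                gcongr
                · exact hκ0 _ _
                · exact hγρ i
                · exact hκK _ _
          _ = Real.exp ((k + 1 : ℕ) * (ρ * K)) := by
              rw [Finset.prod_const, Finset.card_range, ← Real.exp_nat_mul]
          _ ≤ Real.exp K := by
              have h2 : ((k + 1 : ℕ) : ℝ) * ρ ≤ 1 := by
                rw [hρ, mul_one_div, div_le_one (by positivity)]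
                exact_mod_cast hk
              refine Real.exp_le_exp.2 ?_
              rw [← mul_assoc]
              exact mul_le_of_le_one_left hK h2
      have h3 : ρ / 2 ≤ γ k := by
        simp only [hγ, hρ]
        rw [div_div, div_le_div_iff₀ (by positivity) (by positivity)]
        have : (k : ℝ) ≤ n + 3 := by exact_mod_cast hk.le
        push_cast
        linarith
      rw [Real.exp_neg, ← div_eq_mul_inv]
      exact div_le_div₀ (hγ0 k).le h3 (hQ0 _ _) h1
    · exact (div_pos (hγ0 k) (hQ0 _ _)).le
  have ha_abs : ∀ k ω, |a k ω| ≤ γ k := fun k ω => by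
    rw [abs_of_nonneg ((hb0 k).trans (hba k ω))]
    exact haγ k ω
  have hbsum : ∀ l ≥ n + 3, c₀ / σ * ρ ≤ ∑ k ∈ Finset.range l, b k ^ 2 := by
    intro l hl
    refine le_trans ?_ (Finset.sum_le_sum_of_subset_of_nonneg (Finset.range_mono hl)
      fun k _ _ => sq_nonneg _)
    rw [Finset.sum_congr rfl (g := fun _ => (ρ / 2 * Real.exp (-K)) ^ 2) fun k hk => by
      simp only [hb, if_pos (Finset.mem_range.1 hk)]]
    rw [Finset.sum_const, Finset.card_range, nsmul_eq_mul]
    have h1 : ((n + 3 : ℕ) : ℝ) * ρ = 1 := by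
      rw [hρ]
      push_cast
      field_simp
    have h2 : ((n + 3 : ℕ) : ℝ) * (ρ / 2 * Real.exp (-K)) ^ 2 =
        (((n + 3 : ℕ) : ℝ) * ρ) * (ρ * Real.exp (-K) ^ 2 / 4) := by ring
    rw [h2, h1, hc₀]
    field_simp
    exact le_rfl
  have hz' : Measurable (z n) := (hz n).mono (ℱ.le n) le_rfl
  have ham' : ∀ k, Measurable (a k) := fun k => (ham k).mono (ℱ.le _) le_rfl
  have hζ' : ∀ k, Measurable (ζ (n + k)) := fun k => (hζ _).mono (ℱ.le _) le_rfl
  set V : ℕ → Ω → ℝ := fun l ω => z n ω + ∑ k ∈ Finset.range l, a k ω * ζ (n + k) ω with hV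
  have hVi : ∀ l p, Integrable (fun ω => V l ω ^ p) μ := fun l p =>
    integrable_sum_mul_pow hz' (hz1 n) ham' ha_abs hζ' (fun k => hζ2 (n + k)) l p
  have hVG : ∀ ω ∈ G, ∀ l, V l ω * Q l ω = z (n + l) ω := by
    intro ω hω l
    induction l with
    | zero => simp [hV, hQ]
    | succ l ih =>
      have h1 : V (l + 1) ω = V l ω + a l ω * ζ (n + l) ω := by
        simp only [hV, Finset.sum_range_succ, add_assoc]
      have h2 : a l ω * Q (l + 1) ω = γ l := div_mul_cancel₀ _ (hQ0 _ _).ne'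
      have h3 : Q (l + 1) ω = Q l ω * (1 + γ l * κ (n + l) ω) := Finset.prod_range_succ _ _
      have h4 := hrec ω hω (n + l) (by omega)
      rw [← add_assoc, h4, ← ih, h1, add_mul, mul_right_comm, h2, h3, ih]
      simp only [hγ]
      rw [← ih]
      ring
  have hVz : ∀ ω ∈ G, ∀ l, |V l ω| ≤ |z (n + l) ω| := fun ω hω l => by
    rw [← hVG ω hω, abs_mul, abs_of_pos (hQ0 l ω)]
    exact le_mul_of_one_le_right (abs_nonneg _) (hQ1 l ω)
  have hVlim : ∀ B, MeasurableSet B →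
      Tendsto (fun l => ∫ ω in B ∩ G, V l ω ^ 2 ∂μ) atTop (nhds 0) := by
    intro B hB
    have h := tendsto_integral_of_dominated_convergence (μ := μ.restrict (B ∩ G))
      (F := fun l ω => V l ω ^ 2) (f := fun _ => 0) (bound := fun _ => 1)
      (fun l => (hVi l 2).aestronglyMeasurable.restrict) (integrable_const _)
      (fun l => ae_restrict_of_forall_mem (hB.inter hGm) fun ω hω => by
        rw [Real.norm_eq_abs, abs_pow]
        exact pow_le_one₀ (abs_nonneg _) ((hVz ω hω.2 l).trans (hz1 _ _)))
      (ae_restrict_of_forall_mem (hB.inter hGm) fun ω hω => by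
        have h1 : Tendsto (fun l => |z (n + l) ω|) atTop (nhds 0) := by
          simpa using ((tendsto_add_atTop_iff_nat n).2 (hlim ω hω.2)).abs.congr fun l => by
            rw [add_comm]
        have h2 := (squeeze_zero (fun l => abs_nonneg _) (hVz ω hω.2) h1).pow 2
        simpa using h2)
    simpa using h
  have hsum : ∀ l, ∑ k ∈ Finset.range l, γ k ^ 2 ≤ 2 * ρ := sum_range_sq_step_le n
  have hmoments : ∀ (B : Set Ω) (Z : Ω → ℝ), MeasurableSet[ℱ n] B → Measurable[ℱ n] Z →
      (∀ ω, |Z ω| ≤ 1) → ∀ l, _ := fun B Z hB hZ hZ1 l =>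
    setIntegral_sum_mul_bounds (μ := μ) (𝒢 := shiftedFiltration ℱ n) (Z := Z) (a := a)
      (ζ := fun k => ζ (n + k)) (A := B) (B := 1) (s := 2 * ρ) (σ := σ) (b := b) (c := γ)
      hB hσ.le hZ hZ1 ham hb0 hba haγ (fun k => hζ (n + k)) (fun k => hζ2 (n + k))
      (fun k => hmean (n + k)) (fun k => hvar (n + k)) hsum l
  set T : Set Ω := {ω | z n ω ^ 2 ≤ 64 * ρ} with hT
  have hTm : MeasurableSet[ℱ n] T := measurableSet_le ((hz n).pow_const 2) measurable_const
  have hB0 : μ.real (A \ T) = 0 := by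
    set B := A \ T with hB
    have hBm : MeasurableSet[ℱ n] B := hA.diff hTm
    have hBm' : MeasurableSet B := ℱ.le n _ hBm
    have hμB : 0 ≤ μ.real B := measureReal_nonneg
    have hS : ∀ l, ∫ ω in B, (V l ω - z n ω) ^ 2 ∂μ ≤ 8 * ρ * μ.real B := by
      intro l
      have h := (hmoments B (fun _ => 0) hBm measurable_const (by simp) l).1
      have h1 : ∀ ω, V l ω - z n ω = 0 + ∑ k ∈ Finset.range l, a k ω * ζ (n + k) ω :=
        fun ω => by simp [hV]
      simp only [h1]
      refine h.trans_eq ?_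
      simp only [ne_eq, OfNat.ofNat_ne_zero, not_false_eq_true, zero_pow, integral_zero]
      ring
    have hSi : ∀ l, Integrable (fun ω => (V l ω - z n ω) ^ 2) μ := fun l => by
      have := integrable_sum_mul_pow (μ := μ) (Z := fun _ => 0) (B := 0) measurable_const (by simp)
        ham' ha_abs hζ' (fun k => hζ2 (n + k)) l 2
      simpa [hV] using this
    have hzi : Integrable (fun ω => z n ω ^ 2) μ :=
      integrable_of_abs_le (C := 1) (hz'.pow_const 2) fun ω => by
        rw [abs_pow]
        exact pow_le_one₀ (abs_nonneg _) (hz1 n ω)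
    have h1 : ∀ l, ∫ ω in B ∩ G, z n ω ^ 2 ∂μ - 16 * ρ * μ.real B ≤
        2 * ∫ ω in B ∩ G, V l ω ^ 2 ∂μ := by
      intro l
      have h2 : ∫ ω in B ∩ G, z n ω ^ 2 ∂μ ≤
          ∫ ω in B ∩ G, (2 * V l ω ^ 2 + 2 * (V l ω - z n ω) ^ 2) ∂μ :=
        integral_mono hzi.integrableOn
          (((hVi l 2).integrableOn.const_mul 2).add ((hSi l).integrableOn.const_mul 2)) fun ω => by
            simp only
            nlinarith [sq_nonneg (2 * V l ω - z n ω)]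
      rw [integral_add ((hVi l 2).integrableOn.const_mul 2) ((hSi l).integrableOn.const_mul 2),
        integral_const_mul, integral_const_mul] at h2
      have h3 : ∫ ω in B ∩ G, (V l ω - z n ω) ^ 2 ∂μ ≤ ∫ ω in B, (V l ω - z n ω) ^ 2 ∂μ :=
        setIntegral_mono_set (hSi l).integrableOn (ae_of_all _ fun ω => sq_nonneg _)
          (Set.inter_subset_left.eventuallyLE)
      linarith [hS l]
    have h2 : ∫ ω in B ∩ G, z n ω ^ 2 ∂μ ≤ 16 * ρ * μ.real B := by
      have := ge_of_tendsto' ((hVlim B hBm').const_mul 2) h1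
      linarith
    have h3 : 64 * ρ * μ.real (B ∩ G) ≤ ∫ ω in B ∩ G, z n ω ^ 2 ∂μ := by
      have h4 : ∫ _ in B ∩ G, 64 * ρ ∂μ = 64 * ρ * μ.real (B ∩ G) := by
        rw [setIntegral_const, smul_eq_mul, mul_comm]
      rw [← h4]
      refine setIntegral_mono_on (integrable_const _) hzi.integrableOn (hBm'.inter hGm)
        fun ω hω => ?_
      exact (not_le.1 hω.1.2).le
    have h5 := measureReal_inter_add_sdiff (μ := μ) (s := B) hGm
    have h6 := hAG B Set.sdiff_subset hBm
    have h7 : ε ≤ 1 / 2 := min_le_left _ _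
    have h8 : μ.real B / 2 ≤ μ.real (B ∩ G) := by nlinarith
    have h9 : 64 * ρ * (μ.real B / 2) ≤ 16 * ρ * μ.real B :=
      (mul_le_mul_of_nonneg_left h8 (by positivity)).trans (h3.trans h2)
    nlinarith
  have hATm : MeasurableSet[ℱ n] (A ∩ T) := hA.inter hTm
  have hATm' : MeasurableSet (A ∩ T) := ℱ.le n _ hATm
  set x : ℝ := μ.real (A ∩ T) with hx
  have hxpos : 0 < x := by
    have := measureReal_inter_add_sdiff (μ := μ) (s := A) (ℱ.le n _ hTm)
    rw [hB0, add_zero] at this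
    rw [hx, this]
    exact hApos
  have hpow : ∀ p : ℕ, ∫ ω in A ∩ T, z n ω ^ (2 * p) ∂μ ≤ (64 * ρ) ^ p * x := by
    intro p
    have h4 : ∫ _ in A ∩ T, (64 * ρ) ^ p ∂μ = (64 * ρ) ^ p * x := by
      rw [setIntegral_const, smul_eq_mul, mul_comm]
    rw [← h4]
    refine setIntegral_mono_on (integrable_of_abs_le (C := 1) (hz'.pow_const _) fun ω => ?_)
      (integrable_const _) hATm' fun ω hω => ?_
    · rw [abs_pow]
      exact pow_le_one₀ (abs_nonneg _) (hz1 n ω)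
    · rw [pow_mul]
      exact pow_le_pow_left₀ (sq_nonneg _) hω.2 p
  have hz2 := hpow 1
  have hz4 := hpow 2
  norm_num at hz2 hz4
  have hmain := mul_measureReal_le_of_tendsto_zero (μ := μ) (V := V) (A := A ∩ T) (G := G)
    (e := ε * x) (p := c₀ * ρ * x) (q := 10000 * ρ ^ 2 * x) (L := L * ρ) (l₀ := n + 3) hGm
    (by positivity) hVi (hVlim _ hATm')
    (fun l hl => by
      refine le_trans ?_ (hmoments (A ∩ T) (z n) hATm (hz n) (hz1 n) l).2.1
      have h1 := mul_le_mul_of_nonneg_left (hbsum l hl) hσ.le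
      have h2 : σ * (c₀ / σ * ρ) = c₀ * ρ := by field_simp
      rw [h2] at h1
      exact mul_le_mul_of_nonneg_right h1 hxpos.le)
    (fun l => by
      refine (hmoments (A ∩ T) (z n) hATm (hz n) (hz1 n) l).2.2.trans ?_
      have h1 := mul_le_mul_of_nonneg_left hz2 hρpos.le
      have h2 : 0 ≤ ρ ^ 2 * x := by positivity
      simp only [← hx]
      nlinarith)
    (hAG _ Set.inter_subset_left hATm)
  have hLε : L * ε ≤ c₀ / 4 := by
    have : L * ε ≤ L * (c₀ / (4 * L)) := mul_le_mul_of_nonneg_left (min_le_right _ _) hLpos.le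
    refine this.trans_eq ?_
    field_simp
  have hLq : 10000 * ρ ^ 2 * x / (L * ρ) = c₀ / 4 * (ρ * x) := by
    rw [hL]
    field_simp
    norm_num
  have hρx : 0 < ρ * x := by positivity
  rw [hLq] at hmain
  have h1 := mul_le_mul_of_nonneg_right hLε hρx.le
  nlinarith [mul_pos hc₀pos hρx]

end NonConvergence

theorem finite_setOf_halfTanh_eq_self {β : ℝ} (hβ : 0 ≤ β) (h2 : β ≠ 2) :
    {x | halfTanh β x = x}.Finite := by
  rcases h2.lt_or_gt with h2 | h2
  · exact (Set.finite_singleton 0).subset fun x hx => halfTanh_eq_self_of_lt_two hβ h2 hx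
  · obtain ⟨b, -, -, hb⟩ := exists_halfTanh_eq_self h2
    refine (Set.toFinite {0, b, -b}).subset fun x (hx : halfTanh β x = x) => ?_
    rcases lt_trichotomy x 0 with h | h | h
    · have := hb (-x) (neg_pos.2 h) (by rw [halfTanh_neg, hx])
      right; right
      rw [Set.mem_singleton_iff, ← this, neg_neg]
    · exact Or.inl h
    · exact Or.inr (Or.inl (hb x h hx))

section Coupled

theorem tendsto_sub_zero_of_coupled {β : ℝ} (hβ : 0 ≤ β) {s t ζ₁ ζ₂ : ℕ → ℝ}
    (hs1 : ∀ n, |s n| ≤ 1) (ht1 : ∀ n, |t n| ≤ 1)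
    (hs : ∀ n, s (n + 1) = s n + 1 / ((n : ℝ) + 3) * (-s n + halfTanh β (t n) + ζ₁ n))
    (ht : ∀ n, t (n + 1) = t n + 1 / ((n : ℝ) + 3) * (-t n + halfTanh β (s n) + ζ₂ n))
    (h₁ : ∃ l, Tendsto (fun n => ∑ k ∈ Finset.range n, 1 / ((k : ℝ) + 3) * ζ₁ k) atTop (nhds l))
    (h₂ : ∃ l, Tendsto (fun n => ∑ k ∈ Finset.range n, 1 / ((k : ℝ) + 3) * ζ₂ k) atTop (nhds l)) :
    Tendsto (fun n => s n - t n) atTop (nhds 0) := by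
  obtain ⟨l₁, h₁⟩ := h₁
  obtain ⟨l₂, h₂⟩ := h₂
  obtain ⟨c, hc, h⟩ := exists_tendsto_of_drift (x := fun n => s n - t n)
    (g := fun n => -(s n - t n) - (halfTanh β (s n) - halfTanh β (t n)))
    (ζ := fun n => ζ₁ n - ζ₂ n) (D := {0}ᶜ) (C := 4) (fun n => by positivity) tendsto_step
    tendsto_sum_step (fun n => by rw [hs, ht]; ring)
    ⟨l₁ - l₂, (h₁.sub h₂).congr fun n => by
      rw [← Finset.sum_sub_distrib]
      exact Finset.sum_congr rfl fun k _ => by ring⟩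
    (fun n => by
      have h3 := abs_le.1 (hs1 n)
      have h4 := abs_le.1 (ht1 n)
      exact abs_le.2 ⟨by linarith, by linarith⟩)
    (fun n => by
      have h3 := abs_le.1 (hs1 n)
      have h4 := abs_le.1 (ht1 n)
      have h5 := abs_le.1 (abs_halfTanh_le_one β (s n))
      have h6 := abs_le.1 (abs_halfTanh_le_one β (t n))
      exact abs_le.2 ⟨by linarith, by linarith⟩)
    (dense_compl_singleton 0)
    (fun c hc => by
      rcases lt_or_gt_of_ne hc with hc | hc
      · refine ⟨-c / 2, by linarith, -c / 2, by linarith, Or.inl (Eventually.of_forall ?_)⟩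
        intro n hn
        have h3 := (abs_le.1 hn).2
        have := monotone_halfTanh hβ (show s n ≤ t n by linarith)
        linarith
      · refine ⟨c / 2, by linarith, c / 2, by linarith, Or.inr (Eventually.of_forall ?_)⟩
        intro n hn
        have h3 := (abs_le.1 hn).1
        have := monotone_halfTanh hβ (show t n ≤ s n by linarith)
        linarith)
  rw [Set.notMem_compl_iff, Set.mem_singleton_iff] at hc
  rwa [hc] at h

theorem exists_tendsto_of_coupled {β : ℝ} (hβ : 0 ≤ β) (h2 : β ≠ 2) {s t ζ₁ ζ₂ : ℕ → ℝ}
    (hs1 : ∀ n, |s n| ≤ 1) (ht1 : ∀ n, |t n| ≤ 1)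
    (hs : ∀ n, s (n + 1) = s n + 1 / ((n : ℝ) + 3) * (-s n + halfTanh β (t n) + ζ₁ n))
    (ht : ∀ n, t (n + 1) = t n + 1 / ((n : ℝ) + 3) * (-t n + halfTanh β (s n) + ζ₂ n))
    (h₁ : ∃ l, Tendsto (fun n => ∑ k ∈ Finset.range n, 1 / ((k : ℝ) + 3) * ζ₁ k) atTop (nhds l))
    (h₂ : ∃ l, Tendsto (fun n => ∑ k ∈ Finset.range n, 1 / ((k : ℝ) + 3) * ζ₂ k) atTop (nhds l)) :
    ∃ c, halfTanh β c = c ∧ Tendsto s atTop (nhds c) ∧ Tendsto t atTop (nhds c) := by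
  have hd := tendsto_sub_zero_of_coupled hβ hs1 ht1 hs ht h₁ h₂
  obtain ⟨l₁, h₁⟩ := h₁
  obtain ⟨l₂, h₂⟩ := h₂
  have hclose : ∀ n, |(halfTanh β (s n) + halfTanh β (t n)) / 2 - halfTanh β ((s n + t n) / 2)| ≤
      β / 4 * |s n - t n| := fun n => by
    have h3 := abs_halfTanh_sub_le hβ (s n) ((s n + t n) / 2)
    have h4 := abs_halfTanh_sub_le hβ (t n) ((s n + t n) / 2)
    rw [show s n - (s n + t n) / 2 = (s n - t n) / 2 by ring, abs_div, abs_two] at h3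
    rw [show t n - (s n + t n) / 2 = -((s n - t n) / 2) by ring, abs_neg, abs_div, abs_two] at h4
    have h5 := abs_le.1 h3
    have h6 := abs_le.1 h4
    exact abs_le.2 ⟨by linarith, by linarith⟩
  have hclose0 : Tendsto (fun n => β / 4 * |s n - t n|) atTop (nhds 0) := by
    simpa using hd.abs.const_mul (β / 4)
  have hcont : Continuous fun x => halfTanh β x - x := (continuous_halfTanh β).sub continuous_id
  obtain ⟨c, hc, h⟩ := exists_tendsto_of_drift (x := fun n => (s n + t n) / 2)
    (g := fun n => -((s n + t n) / 2) + (halfTanh β (s n) + halfTanh β (t n)) / 2)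
    (ζ := fun n => (ζ₁ n + ζ₂ n) / 2) (D := {x | halfTanh β x = x}ᶜ) (C := 2)
    (fun n => by positivity) tendsto_step tendsto_sum_step (fun n => by rw [hs, ht]; ring)
    ⟨(l₁ + l₂) / 2, ((h₁.add h₂).div_const 2).congr fun n => by
      rw [← Finset.sum_add_distrib, Finset.sum_div]
      exact Finset.sum_congr rfl fun k _ => by ring⟩
    (fun n => by
      have h3 := abs_le.1 (hs1 n)
      have h4 := abs_le.1 (ht1 n)
      exact abs_le.2 ⟨by linarith, by linarith⟩)
    (fun n => by
      have h3 := abs_le.1 (hs1 n)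
      have h4 := abs_le.1 (ht1 n)
      have h5 := abs_le.1 (abs_halfTanh_le_one β (s n))
      have h6 := abs_le.1 (abs_halfTanh_le_one β (t n))
      exact abs_le.2 ⟨by linarith, by linarith⟩)
    ((finite_setOf_halfTanh_eq_self hβ h2).countable.dense_compl ℝ)
    (fun c hc => by
      have hne : halfTanh β c - c ≠ 0 := sub_ne_zero.2 hc
      set ε := |halfTanh β c - c| / 4 with hε
      have hεpos : 0 < ε := by positivity
      obtain ⟨δ, hδ, hball⟩ := Metric.continuousAt_iff.1 (hcont.continuousAt (x := c)) ε hεpos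
      have hev := hclose0.eventually_le_const hεpos
      refine ⟨δ / 2, by positivity, ε, hεpos, ?_⟩
      have key : ∀ n, β / 4 * |s n - t n| ≤ ε → |(s n + t n) / 2 - c| ≤ δ / 2 →
          |-((s n + t n) / 2) + (halfTanh β (s n) + halfTanh β (t n)) / 2 -
            (halfTanh β c - c)| ≤ 2 * ε := fun n hn hnc => by
        have h3 := hball (x := (s n + t n) / 2) (by rw [Real.dist_eq]; linarith)
        rw [Real.dist_eq] at h3
        have h4 := abs_lt.1 h3
        have h5 := abs_le.1 ((hclose n).trans hn)
        exact abs_le.2 ⟨by linarith, by linarith⟩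
      rcases lt_or_gt_of_ne hne with h3 | h3
      · rw [abs_of_neg h3] at hε
        refine Or.inr (hev.mono fun n hn hnc => ?_)
        have := (abs_le.1 (key n hn hnc)).2
        linarith
      · rw [abs_of_pos h3] at hε
        refine Or.inl (hev.mono fun n hn hnc => ?_)
        have := (abs_le.1 (key n hn hnc)).1
        linarith)
  refine ⟨c, not_not.1 hc, ?_, ?_⟩
  · simpa using (h.add (hd.div_const 2)).congr fun n =>
      show (s n + t n) / 2 + (s n - t n) / 2 = s n by ring
  · simpa using (h.sub (hd.div_const 2)).congr fun n =>
      show (s n + t n) / 2 - (s n - t n) / 2 = t n by ring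

end Coupled

section CoupledCoordinates

variable {Ω : Type*} {m0 : MeasurableSpace Ω} {μ : Measure Ω}

/-- The relative expansion rate of the mean of two coupled coordinates, truncated from below. -/
noncomputable def coupledRate (β s t : ℝ) : ℝ :=
  max 0 (((halfTanh β s + halfTanh β t) / 2 - (s + t) / 2) / ((s + t) / 2))

theorem coupledRate_le {β : ℝ} (hβ : 0 ≤ β) (s t : ℝ) : coupledRate β s t ≤ β / 2 := by
  refine max_le (by positivity) ?_
  have h := abs_halfTanh_sub_le hβ s (-t)
  rw [halfTanh_neg, sub_neg_eq_add, sub_neg_eq_add] at h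
  rcases eq_or_ne (s + t) 0 with h0 | h0
  · simp only [h0, zero_div, div_zero]
    positivity
  · rw [sub_div, div_self (div_ne_zero h0 two_ne_zero), div_div_div_cancel_right₀ two_ne_zero]
    have h1 : (halfTanh β s + halfTanh β t) / (s + t) ≤ β / 2 := by
      refine (le_abs_self _).trans ?_
      rwa [abs_div, div_le_iff₀ (abs_pos.2 h0)]
    linarith

theorem coupledRate_mul {β r s t : ℝ}
    (hr : ∀ x y, |x| ≤ r → |y| ≤ r → x ≤ y → y - x ≤ halfTanh β y - halfTanh β x)
    (hs : |s| ≤ r) (ht : |t| ≤ r) :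
    coupledRate β s t * ((s + t) / 2) = (halfTanh β s + halfTanh β t) / 2 - (s + t) / 2 := by
  have ht' : |-t| ≤ r := by rwa [abs_neg]
  have h1 := hr (-t) s ht' hs
  have h2 := hr s (-t) hs ht'
  rw [halfTanh_neg] at h1 h2
  rcases eq_or_ne (s + t) 0 with h0 | h0
  · have hst : s = -t := by linarith
    rw [h0, hst, halfTanh_neg]
    ring
  · rw [coupledRate, max_eq_right, div_mul_cancel₀ _ (div_ne_zero h0 two_ne_zero)]
    rcases lt_or_gt_of_ne h0 with h | h
    · exact div_nonneg_of_nonpos (by linarith [h2 (by linarith)]) (by linarith)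
    · exact div_nonneg (by linarith [h1 (by linarith)]) (by linarith)

theorem ae_exists_tendsto_of_coupled [IsProbabilityMeasure μ] {ℱ : Filtration ℕ m0} {β σ : ℝ}
    (hβ : 0 ≤ β) (h2 : β ≠ 2) (hσ : 0 < σ) {s t ζ₁ ζ₂ : ℕ → Ω → ℝ}
    (hsm : ∀ n, Measurable[ℱ n] (s n)) (htm : ∀ n, Measurable[ℱ n] (t n))
    (hs1 : ∀ n ω, |s n ω| ≤ 1) (ht1 : ∀ n ω, |t n ω| ≤ 1)
    (hζ₁ : ∀ n, Measurable[ℱ (n + 1)] (ζ₁ n)) (hζ₂ : ∀ n, Measurable[ℱ (n + 1)] (ζ₂ n))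
    (hζ₁2 : ∀ n ω, |ζ₁ n ω| ≤ 2) (hζ₂2 : ∀ n ω, |ζ₂ n ω| ≤ 2)
    (hmean₁ : ∀ n, μ[ζ₁ n | ℱ n] =ᵐ[μ] 0) (hmean₂ : ∀ n, μ[ζ₂ n | ℱ n] =ᵐ[μ] 0)
    (hvar : ∀ n, ∀ᵐ ω ∂μ, σ ≤ (μ[fun ω => ((ζ₁ n ω + ζ₂ n ω) / 2) ^ 2 | ℱ n]) ω)
    (hs : ∀ n ω, s (n + 1) ω =
      s n ω + 1 / ((n : ℝ) + 3) * (-s n ω + halfTanh β (t n ω) + ζ₁ n ω))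
    (ht : ∀ n ω, t (n + 1) ω =
      t n ω + 1 / ((n : ℝ) + 3) * (-t n ω + halfTanh β (s n ω) + ζ₂ n ω)) :
    ∀ᵐ ω ∂μ, ∃ c, halfTanh β c = c ∧ (2 < β → c ≠ 0) ∧
      Tendsto (fun n => s n ω) atTop (nhds c) ∧ Tendsto (fun n => t n ω) atTop (nhds c) := by
  have hnull : 2 < β → ∀ᵐ ω ∂μ, ¬ (Tendsto (fun n => s n ω) atTop (nhds 0) ∧
      Tendsto (fun n => t n ω) atTop (nhds 0)) := by
    intro hβ2
    obtain ⟨r, hr0, hr⟩ := exists_sub_le_halfTanh_sub hβ2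
    have hsm' : ∀ n, Measurable[⨆ n, ℱ n] (s n) := fun n =>
      (hsm n).mono (le_iSup (fun n => (ℱ n : MeasurableSpace Ω)) n) le_rfl
    have htm' : ∀ n, Measurable[⨆ n, ℱ n] (t n) := fun n =>
      (htm n).mono (le_iSup (fun n => (ℱ n : MeasurableSpace Ω)) n) le_rfl
    set G : ℕ → Set Ω := fun N => (⋂ n, ⋂ (_ : N ≤ n), {ω | |s n ω| ≤ r} ∩ {ω | |t n ω| ≤ r}) ∩
      {ω | Tendsto (fun n => (s n ω + t n ω) / 2) atTop (nhds 0)} with hG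
    have hGmem : ∀ {N ω}, ω ∈ G N → ∀ n ≥ N, |s n ω| ≤ r ∧ |t n ω| ≤ r := fun h n hn =>
      Set.mem_iInter₂.1 h.1 n hn
    have hGm : ∀ N, MeasurableSet[⨆ n, ℱ n] (G N) := fun N => by
      refine MeasurableSet.inter (MeasurableSet.iInter fun n => MeasurableSet.iInter fun _ =>
        (hsm' n (measurableSet_le continuous_abs.measurable measurable_const)).inter
          (htm' n (measurableSet_le continuous_abs.measurable measurable_const))) ?_
      exact measurableSet_tendsto _ fun n => ((hsm' n).add (htm' n)).div_const 2
    have hG0 : ∀ N, μ (G N) = 0 := fun N => by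
      refine measure_eq_zero_of_repelling (z := fun n ω => (s n ω + t n ω) / 2)
        (κ := fun n ω => coupledRate β (s n ω) (t n ω)) (ζ := fun n ω => (ζ₁ n ω + ζ₂ n ω) / 2)
        (σ := σ) (K := β / 2) (N := N) hσ (by positivity)
        (fun n => ((hsm n).add (htm n)).div_const 2) (fun n ω => ?_) (fun n => ?_)
        (fun n ω => le_max_left _ _) (fun n ω => coupledRate_le hβ _ _)
        (fun n => ((hζ₁ n).add (hζ₂ n)).div_const 2) (fun n ω => ?_) (fun n => ?_) hvar (hGm N)
        (fun ω hω n hn => ?_) (fun ω hω => hω.2)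
      · have h3 := abs_le.1 (hs1 n ω)
        have h4 := abs_le.1 (ht1 n ω)
        exact abs_le.2 ⟨by linarith, by linarith⟩
      · have hf := (continuous_halfTanh β).measurable
        exact measurable_const.max (((((hf.comp (hsm n)).add (hf.comp (htm n))).div_const 2).sub
          (((hsm n).add (htm n)).div_const 2)).div (((hsm n).add (htm n)).div_const 2))
      · have h3 := abs_le.1 (hζ₁2 n ω)
        have h4 := abs_le.1 (hζ₂2 n ω)
        exact abs_le.2 ⟨by linarith, by linarith⟩
      · have hi₁ : Integrable (ζ₁ n) μ :=
          integrable_of_abs_le ((hζ₁ n).mono (ℱ.le _) le_rfl) (hζ₁2 n)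
        have hi₂ : Integrable (ζ₂ n) μ :=
          integrable_of_abs_le ((hζ₂ n).mono (ℱ.le _) le_rfl) (hζ₂2 n)
        have h3 : (fun ω => (ζ₁ n ω + ζ₂ n ω) / 2) = (2⁻¹ : ℝ) • (ζ₁ n + ζ₂ n) := by
          ext ω
          simp only [Pi.smul_apply, Pi.add_apply, smul_eq_mul]
          ring
        rw [h3]
        filter_upwards [condExp_smul (2⁻¹ : ℝ) (ζ₁ n + ζ₂ n) (ℱ n) (μ := μ),
          condExp_add hi₁ hi₂ (ℱ n), hmean₁ n, hmean₂ n] with ω h4 h5 h6 h7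
        rw [h4, Pi.smul_apply, h5, Pi.add_apply, h6, h7]
        simp
      · obtain ⟨h3, h4⟩ := hGmem hω n hn
        simp only [hs, ht, coupledRate_mul hr h3 h4]
        ring
    have hU : ∀ᵐ ω ∂μ, ∀ N, ω ∉ G N := ae_all_iff.2 fun N => measure_eq_zero_iff_ae_notMem.1 (hG0 N)
    filter_upwards [hU] with ω hω ⟨h3, h4⟩
    have h5 : ∀ᶠ n in atTop, |s n ω| ≤ r ∧ |t n ω| ≤ r := by
      have h6 := h3.abs
      have h7 := h4.abs
      rw [abs_zero] at h6 h7
      exact (h6.eventually_le_const hr0).and (h7.eventually_le_const hr0)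
    obtain ⟨N, hN⟩ := eventually_atTop.1 h5
    refine hω N ⟨Set.mem_iInter₂.2 hN, ?_⟩
    simpa using (h3.add h4).div_const 2
  have hnull' : ∀ᵐ ω ∂μ, 2 < β → ¬ (Tendsto (fun n => s n ω) atTop (nhds 0) ∧
      Tendsto (fun n => t n ω) atTop (nhds 0)) := by
    by_cases hβ2 : 2 < β
    · filter_upwards [hnull hβ2] with ω hω _ using hω
    · exact ae_of_all _ fun ω h => absurd h hβ2
  filter_upwards [ae_exists_tendsto_sum_step_mul hζ₁ hζ₁2 hmean₁,
    ae_exists_tendsto_sum_step_mul hζ₂ hζ₂2 hmean₂, hnull'] with ω h3 h4 h5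
  obtain ⟨c, hc, h6, h7⟩ := exists_tendsto_of_coupled hβ h2 (fun n => hs1 n ω) (fun n => ht1 n ω)
    (fun n => hs n ω) (fun n => ht n ω) h3 h4
  refine ⟨c, hc, fun hβ2 hc0 => ?_, h6, h7⟩
  rw [hc0] at h6 h7
  exact h5 hβ2 ⟨h6, h7⟩

end CoupledCoordinates

section Occupation

variable {Ω : Type*} {m m0 : MeasurableSpace Ω} {μ : Measure Ω}

theorem occ_succ (W : ℕ → Ω → Fin 2 → Fin 2) (n : ℕ) (ω : Ω) (i v : Fin 2) :
    occ 2 2 W (n + 1) ω i v = occ 2 2 W n ω i v +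
      1 / ((n : ℝ) + 3) * ((if W (n + 1) ω i = v then 1 else 0) - occ 2 2 W n ω i v) := by
  unfold occ
  rw [Finset.sum_Icc_succ_top (by omega)]
  push_cast
  field_simp
  ring

theorem occ_nonneg (W : ℕ → Ω → Fin 2 → Fin 2) (n : ℕ) (ω : Ω) (i v : Fin 2) :
    0 ≤ occ 2 2 W n ω i v := by
  have : 0 ≤ ∑ k ∈ Finset.Icc 1 n, if W k ω i = v then (1 : ℝ) else 0 :=
    Finset.sum_nonneg fun k _ => by split_ifs <;> norm_num
  unfold occ
  positivity

theorem occ_zero_add_occ_one (W : ℕ → Ω → Fin 2 → Fin 2) (n : ℕ) (ω : Ω) (i : Fin 2) :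
    occ 2 2 W n ω i 0 + occ 2 2 W n ω i 1 = 1 := by
  have h : ∀ k, ((if W k ω i = 0 then (1 : ℝ) else 0) + if W k ω i = 1 then (1 : ℝ) else 0) = 1 :=
    fun k => by
      generalize W k ω i = w
      fin_cases w <;> simp
  have h' : (∑ k ∈ Finset.Icc 1 n, if W k ω i = 0 then (1 : ℝ) else 0) +
      (∑ k ∈ Finset.Icc 1 n, if W k ω i = 1 then (1 : ℝ) else 0) = n := by
    rw [← Finset.sum_add_distrib, Finset.sum_congr rfl fun k _ => h k]
    simp
  unfold occ
  rw [← add_div, div_eq_one_iff_eq (by positivity)]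
  push_cast
  linarith

theorem occ_le_one (W : ℕ → Ω → Fin 2 → Fin 2) (n : ℕ) (ω : Ω) (i v : Fin 2) :
    occ 2 2 W n ω i v ≤ 1 := by
  have h := occ_zero_add_occ_one W n ω i
  have h0 := occ_nonneg W n ω i 0
  have h1 := occ_nonneg W n ω i 1
  fin_cases v <;> simp only [Fin.zero_eta, Fin.mk_one] <;> linarith

theorem piMap_repelling {β : ℝ} {α : Fin 2 → Fin 2 → Fin 2 → ℝ}
    (hα : ∀ v i j, α v i j = if i = j then 0 else -β) {x : Fin 2 → Fin 2 → ℝ}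
    (hx : ∀ i, x i 0 + x i 1 = 1) (i v : Fin 2) :
    piMap 2 2 α x i v = (1 - halfTanh β (2 * x (1 - i) v - 1)) / 2 := by
  have key : ∀ p q : ℝ, p + q = 1 → Real.exp (-(β * p)) /
      (Real.exp (-(β * p)) + Real.exp (-(β * q))) = (1 - halfTanh β (2 * p - 1)) / 2 := by
    intro p q hpq
    have h : Real.exp (-(β * q)) = Real.exp (-(β * p)) * Real.exp (β * (2 * p - 1)) := by
      rw [← Real.exp_add]
      congr 1
      rw [← hpq]
      ring
    have h1 := Real.exp_pos (-(β * p))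
    have h2 := Real.exp_pos (β * (2 * p - 1))
    rw [halfTanh, h]
    field_simp
    ring
  have h0 := hx 0
  have h1 := hx 1
  fin_cases i <;> fin_cases v <;> simp [piMap, hα, Fin.sum_univ_two]
  · exact key _ _ h1
  · rw [add_comm (Real.exp _)]
    exact key _ _ (by linarith)
  · exact key _ _ h0
  · rw [add_comm (Real.exp _)]
    exact key _ _ (by linarith)

theorem condExp_const_mul_sub_eq_zero (hm : m ≤ m0) [IsFiniteMeasure μ] {Y p : Ω → ℝ} {C : ℝ}
    (hY : Integrable Y μ) (hp : Measurable[m] p) (hpC : ∀ ω, |p ω| ≤ C) (h : μ[Y | m] =ᵐ[μ] p)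
    (c : ℝ) : μ[fun ω => c * (Y ω - p ω) | m] =ᵐ[μ] 0 := by
  have hpi : Integrable p μ := integrable_of_abs_le (hp.mono hm le_rfl) hpC
  change μ[c • (Y - p) | m] =ᵐ[μ] 0
  filter_upwards [condExp_smul c (Y - p) m (μ := μ), condExp_sub hY hpi m, h] with ω h1 h2 h3
  rw [h1, Pi.smul_apply, h2, Pi.sub_apply, h3,
    condExp_of_stronglyMeasurable hm hp.stronglyMeasurable hpi]
  simp

theorem measurable_visit {W : ℕ → Ω → Fin 2 → Fin 2} {ℱ : Filtration ℕ m0}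
    (hℱ : ∀ n, ℱ n = ⨆ k ∈ Finset.Icc 1 n, MeasurableSpace.comap (W k) ⊤) {k n : ℕ}
    (hk : k ∈ Finset.Icc 1 n) (i v : Fin 2) :
    Measurable[ℱ n] fun ω => if W k ω i = v then (1 : ℝ) else 0 := by
  have h : Measurable[ℱ n, ⊤] (W k) := by
    rw [measurable_iff_comap_le, hℱ]
    exact le_iSup₂ (f := fun k _ => MeasurableSpace.comap (W k) ⊤) k hk
  have h1 : Measurable[⊤] fun w : Fin 2 → Fin 2 => if w i = v then (1 : ℝ) else 0 :=
    measurable_from_top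
  exact h1.comp h

theorem measurable_occ {W : ℕ → Ω → Fin 2 → Fin 2} {ℱ : Filtration ℕ m0}
    (hℱ : ∀ n, ℱ n = ⨆ k ∈ Finset.Icc 1 n, MeasurableSpace.comap (W k) ⊤) (n : ℕ) (i v : Fin 2) :
    Measurable[ℱ n] fun ω => occ 2 2 W n ω i v :=
  ((Finset.measurable_fun_sum _ fun _ hk => measurable_visit hℱ hk i v).const_add 1).div_const _

theorem ae_exists_tendsto_occ [IsProbabilityMeasure μ] {β : ℝ} (hβ : 0 ≤ β) (h2 : β ≠ 2)
    {α : Fin 2 → Fin 2 → Fin 2 → ℝ} (hα : ∀ v i j, α v i j = if i = j then 0 else -β)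
    {W : ℕ → Ω → Fin 2 → Fin 2} {ℱ : Filtration ℕ m0}
    (hℱ : ∀ n, ℱ n = ⨆ k ∈ Finset.Icc 1 n, MeasurableSpace.comap (W k) ⊤)
    (hcond : ∀ n (i : Fin 2) (v : Fin 2),
      (μ[fun ω => if W (n + 1) ω i = v then (1 : ℝ) else 0 | ℱ n])
        =ᵐ[μ] fun ω => piMap 2 2 α (occ 2 2 W n ω) i v)
    (hindep : ∀ n (v : Fin 2 → Fin 2),
      (μ[fun ω => if (∀ i, W (n + 1) ω i = v i) then (1 : ℝ) else 0 | ℱ n])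
        =ᵐ[μ] fun ω => ∏ i, piMap 2 2 α (occ 2 2 W n ω) i (v i)) :
    ∀ᵐ ω ∂μ, ∃ c, halfTanh β c = c ∧ (2 < β → c ≠ 0) ∧
      Tendsto (fun n => occ 2 2 W n ω) atTop
        (nhds ![![(1 - c) / 2, (1 + c) / 2], ![(1 + c) / 2, (1 - c) / 2]]) := by
  set ε : ℝ := (1 - halfTanh β 1) / 2 with hε
  have hεpos : 0 < ε := by linarith [halfTanh_lt_one β 1]
  set q : Fin 2 → Fin 2 → ℕ → Ω → ℝ :=
    fun i v n ω => (1 - halfTanh β (2 * occ 2 2 W n ω (1 - i) v - 1)) / 2 with hq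
  have hπ : ∀ i v n ω, piMap 2 2 α (occ 2 2 W n ω) i v = q i v n ω := fun i v n ω =>
    piMap_repelling hα (occ_zero_add_occ_one W n ω) i v
  have hqε : ∀ i v n ω, ε ≤ q i v n ω := fun i v n ω => by
    have := monotone_halfTanh hβ
      (show 2 * occ 2 2 W n ω (1 - i) v - 1 ≤ 1 by linarith [occ_le_one W n ω (1 - i) v])
    simp only [hq, hε]
    linarith
  have hq1 : ∀ i v n ω, q i v n ω ≤ 1 := fun i v n ω => by
    have := neg_one_lt_halfTanh β (2 * occ 2 2 W n ω (1 - i) v - 1)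
    simp only [hq]
    linarith
  have hqabs : ∀ i v n ω, |q i v n ω| ≤ 1 := fun i v n ω => by
    rw [abs_of_nonneg (hεpos.le.trans (hqε i v n ω))]
    exact hq1 i v n ω
  have hqm : ∀ i v n, Measurable[ℱ n] (q i v n) := fun i v n =>
    ((((continuous_halfTanh β).measurable.comp
      (((measurable_occ hℱ n (1 - i) v).const_mul 2).sub_const 1)).const_sub 1).div_const 2)
  set Y : Fin 2 → ℕ → Ω → ℝ := fun i n ω => if W (n + 1) ω i = 0 then 1 else 0 with hY
  have hYm : ∀ i n, Measurable[ℱ (n + 1)] (Y i n) := fun i n =>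
    measurable_visit hℱ (Finset.mem_Icc.2 ⟨by omega, le_rfl⟩) i 0
  have hY01 : ∀ i n ω, 0 ≤ Y i n ω ∧ Y i n ω ≤ 1 := fun i n ω => by
    simp only [hY]
    split_ifs <;> norm_num
  have hYi : ∀ i n, Integrable (Y i n) μ := fun i n =>
    integrable_of_abs_le (C := 1) ((hYm i n).mono (ℱ.le _) le_rfl) fun ω => by
      rw [abs_of_nonneg (hY01 i n ω).1]
      exact (hY01 i n ω).2
  have hYq : ∀ i n, μ[Y i n | ℱ n] =ᵐ[μ] q i 0 n := fun i n => by
    filter_upwards [hcond n i 0] with ω hω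
    rw [← hπ, ← hω]
  have hnoise : ∀ i n ω, |Y i n ω - q i 0 n ω| ≤ 1 := fun i n ω => by
    have h3 := hY01 i n ω
    have h4 := hqε i 0 n ω
    have h5 := hq1 i 0 n ω
    exact abs_le.2 ⟨by linarith, by linarith⟩
  have hζm : ∀ (c : ℝ) i n, Measurable[ℱ (n + 1)] fun ω => c * (Y i n ω - q i 0 n ω) :=
    fun c i n => ((hYm i n).sub ((hqm i 0 n).mono (ℱ.mono n.le_succ) le_rfl)).const_mul c
  have hvar : ∀ n, ∀ᵐ ω ∂μ, ε ^ 4 ≤ (μ[fun ω => ((-2 * (Y 0 n ω - q 0 0 n ω) +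
      2 * (Y 1 n ω - q 1 0 n ω)) / 2) ^ 2 | ℱ n]) ω := by
    intro n
    set V : Ω → ℝ := fun ω => if ∀ i, W (n + 1) ω i = ![1, 0] i then 1 else 0 with hV
    have hVY : ∀ ω, V ω = (1 - Y 0 n ω) * Y 1 n ω := fun ω => by
      simp only [hV, hY, Fin.forall_fin_two]
      generalize W (n + 1) ω 0 = w₀
      generalize W (n + 1) ω 1 = w₁
      fin_cases w₀ <;> fin_cases w₁ <;> simp
    have hle : ∀ ω, ε ^ 2 * V ω ≤ ((-2 * (Y 0 n ω - q 0 0 n ω) +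
        2 * (Y 1 n ω - q 1 0 n ω)) / 2) ^ 2 := fun ω => by
      have h3 := hqε 0 0 n ω
      have h4 := hq1 1 0 n ω
      have h5 : Y 0 n ω = 0 ∨ Y 0 n ω = 1 := by
        simp only [hY]
        split_ifs <;> simp
      have h6 : Y 1 n ω = 0 ∨ Y 1 n ω = 1 := by
        simp only [hY]
        split_ifs <;> simp
      rw [hVY]
      rcases h5 with h5 | h5
      · rcases h6 with h6 | h6
        · simp only [h6, mul_zero]
          positivity
        · rw [h5, h6]
          nlinarith
      · simp only [h5, sub_self, zero_mul, mul_zero]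
        positivity
    have hVi : Integrable V μ := by
      have : V = fun ω => (1 - Y 0 n ω) * Y 1 n ω := funext hVY
      rw [this]
      refine integrable_of_abs_le (C := 1) ((((hYm 0 n).const_sub 1).mul (hYm 1 n)).mono
        (ℱ.le _) le_rfl) fun ω => ?_
      have h3 := hY01 0 n ω
      have h4 := hY01 1 n ω
      exact abs_le.2 ⟨by nlinarith, by nlinarith⟩
    have hζi : Integrable (fun ω => ((-2 * (Y 0 n ω - q 0 0 n ω) +
        2 * (Y 1 n ω - q 1 0 n ω)) / 2) ^ 2) μ := by
      refine integrable_of_abs_le (C := 4) (((((hζm _ 0 n).add (hζm _ 1 n)).div_const 2).pow_const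
        2).mono (ℱ.le _) le_rfl) fun ω => ?_
      have h3 := abs_le.1 (hnoise 0 n ω)
      have h4 := abs_le.1 (hnoise 1 n ω)
      rw [abs_pow, show (4 : ℝ) = 2 ^ 2 by norm_num]
      exact pow_le_pow_left₀ (abs_nonneg _) (abs_le.2 ⟨by linarith, by linarith⟩) 2
    filter_upwards [condExp_mono (m := ℱ n) (hVi.const_mul (ε ^ 2)) hζi (ae_of_all _ hle),
      condExp_smul (ε ^ 2) V (ℱ n) (μ := μ), hindep n ![1, 0]] with ω h3 h4 h5
    refine le_trans ?_ h3
    change _ ≤ (μ[ε ^ 2 • V | ℱ n]) ω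
    rw [h4, Pi.smul_apply, h5, Fin.prod_univ_two, hπ, hπ, smul_eq_mul]
    have h6 := mul_le_mul (hqε 0 (![1, 0] 0) n ω) (hqε 1 (![1, 0] 1) n ω) hεpos.le
      (hεpos.le.trans (hqε _ _ _ _))
    calc ε ^ 4 = ε ^ 2 * (ε * ε) := by ring
      _ ≤ _ := mul_le_mul_of_nonneg_left h6 (sq_nonneg ε)
  have habs : ∀ i v n ω, |2 * occ 2 2 W n ω i v - 1| ≤ 1 := fun i v n ω =>
    abs_le.2 ⟨by linarith [occ_nonneg W n ω i v], by linarith [occ_le_one W n ω i v]⟩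
  have hζ2 : ∀ (c : ℝ) i n ω, |c| = 2 → |c * (Y i n ω - q i 0 n ω)| ≤ 2 := fun c i n ω hc => by
    rw [abs_mul, hc]
    linarith [hnoise i n ω]
  have hmean : ∀ (c : ℝ) i n, μ[fun ω => c * (Y i n ω - q i 0 n ω) | ℱ n] =ᵐ[μ] 0 := fun c i n =>
    condExp_const_mul_sub_eq_zero (ℱ.le n) (hYi i n) (hqm i 0 n) (hqabs i 0 n) (hYq i n) c
  filter_upwards [ae_exists_tendsto_of_coupled (μ := μ) (ℱ := ℱ) hβ h2 (pow_pos hεpos 4)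
    (s := fun n ω => 1 - 2 * occ 2 2 W n ω 0 0) (t := fun n ω => 2 * occ 2 2 W n ω 1 0 - 1)
    (ζ₁ := fun n ω => -2 * (Y 0 n ω - q 0 0 n ω)) (ζ₂ := fun n ω => 2 * (Y 1 n ω - q 1 0 n ω))
    (fun n => ((measurable_occ hℱ n 0 0).const_mul 2).const_sub 1)
    (fun n => ((measurable_occ hℱ n 1 0).const_mul 2).sub_const 1)
    (fun n ω => by rw [abs_sub_comm]; exact habs 0 0 n ω) (habs 1 0)
    (hζm _ 0) (hζm _ 1) (fun n ω => hζ2 _ 0 n ω (by norm_num))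
    (fun n ω => hζ2 _ 1 n ω (by norm_num))
    (hmean _ 0) (hmean _ 1) hvar
    (fun n ω => by
      simp only [occ_succ, hY, hq, sub_zero]
      ring)
    (fun n ω => by
      have h3 : 1 - 2 * occ 2 2 W n ω 0 0 = -(2 * occ 2 2 W n ω 0 0 - 1) := by ring
      simp only [h3, halfTanh_neg, occ_succ, hY, hq, sub_self]
      ring)] with ω ⟨c, hc, hc0, hs, ht⟩
  refine ⟨c, hc, hc0, ?_⟩
  have h00 : Tendsto (fun n => occ 2 2 W n ω 0 0) atTop (nhds ((1 - c) / 2)) :=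
    ((hs.const_sub 1).div_const 2).congr fun n => by ring
  have h10 : Tendsto (fun n => occ 2 2 W n ω 1 0) atTop (nhds ((1 + c) / 2)) :=
    ((ht.const_add 1).div_const 2).congr fun n => by ring
  have h01 : Tendsto (fun n => occ 2 2 W n ω 0 1) atTop (nhds ((1 + c) / 2)) := by
    convert (h00.const_sub 1).congr fun n =>
      show 1 - occ 2 2 W n ω 0 0 = occ 2 2 W n ω 0 1 by linarith [occ_zero_add_occ_one W n ω 0]
      using 2
    ring
  have h11 : Tendsto (fun n => occ 2 2 W n ω 1 1) atTop (nhds ((1 - c) / 2)) := by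
    convert (h10.const_sub 1).congr fun n =>
      show 1 - occ 2 2 W n ω 1 0 = occ 2 2 W n ω 1 1 by linarith [occ_zero_add_occ_one W n ω 1]
      using 2
    ring
  refine tendsto_pi_nhds.2 fun i => tendsto_pi_nhds.2 fun v => ?_
  fin_cases i <;> fin_cases v
  exacts [h00, h01, h10, h11]

end Occupation

/-- Two repelling walks on the two-vertex graph (`d = m = 2`, `α_v^{ij} = -β` for `i ≠ j`,
`α_v^{ii} = 0`): if `β ∈ [0, 2)` the occupation measure process converges a.s. to
`(1/2, 1/2, 1/2, 1/2)`; if `β > 2` it converges a.s. to `(a, 1-a, 1-a, a)` or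
`(1-a, a, a, 1-a)`, where `a ∈ (0, 1/2)` is the unique solution of
`a = 1/(1 + e^{β(1-2a)})` in `(0, 1/2)`. -/
theorem two_repelling_walks_on_K2 (β : ℝ) (hβ : 0 ≤ β)
    (α : Fin 2 → Fin 2 → Fin 2 → ℝ)
    (hα : ∀ v i j, α v i j = if i = j then 0 else -β)
    {Ω : Type*} [MeasurableSpace Ω] (ℙ : Measure Ω) [IsProbabilityMeasure ℙ]
    (W : ℕ → Ω → Fin 2 → Fin 2) (hWmeas : ∀ n, Measurable (W n))
    (ℱ : Filtration ℕ ‹MeasurableSpace Ω›)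
    (hℱ : ∀ n, ℱ n = ⨆ k ∈ Finset.Icc 1 n, MeasurableSpace.comap (W k) ⊤)
    (hcond : ∀ n (i : Fin 2) (v : Fin 2),
      (ℙ[fun ω => if W (n + 1) ω i = v then (1 : ℝ) else 0 | ℱ n])
        =ᵐ[ℙ] fun ω => piMap 2 2 α (occ 2 2 W n ω) i v)
    (hindep : ∀ n (v : Fin 2 → Fin 2),
      (ℙ[fun ω => if (∀ i, W (n + 1) ω i = v i) then (1 : ℝ) else 0 | ℱ n])
        =ᵐ[ℙ] fun ω => ∏ i, piMap 2 2 α (occ 2 2 W n ω) i (v i)) :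
    (β < 2 → ∀ᵐ ω ∂ℙ,
      Tendsto (fun n => occ 2 2 W n ω) atTop
        (nhds ![![(1 : ℝ) / 2, 1 / 2], ![1 / 2, 1 / 2]])) ∧
    (2 < β → ∃ a : ℝ,
      a ∈ Set.Ioo (0 : ℝ) (1 / 2) ∧
      a = 1 / (1 + Real.exp (β * (1 - 2 * a))) ∧
      (∀ a' ∈ Set.Ioo (0 : ℝ) (1 / 2),
        a' = 1 / (1 + Real.exp (β * (1 - 2 * a'))) → a' = a) ∧
      ∀ᵐ ω ∂ℙ,
        (Tendsto (fun n => occ 2 2 W n ω) atTop (nhds ![![a, 1 - a], ![1 - a, a]]) ∨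
          Tendsto (fun n => occ 2 2 W n ω) atTop (nhds ![![1 - a, a], ![a, 1 - a]]))) := by
  refine ⟨fun h2 => ?_, fun h2 => ?_⟩
  · filter_upwards [ae_exists_tendsto_occ hβ h2.ne hα hℱ hcond hindep] with ω ⟨c, hc, _, h⟩
    simpa [halfTanh_eq_self_of_lt_two hβ h2 hc] using h
  · obtain ⟨b, hb, hfix, huniq⟩ := exists_halfTanh_eq_self h2
    refine ⟨(1 - b) / 2, ⟨by linarith [hb.2], by linarith [hb.1]⟩, ?_,
      fun a ha h => ?_, ?_⟩
    · rw [half_one_sub_eq_iff_halfTanh_eq_self, show 1 - 2 * ((1 - b) / 2) = b by ring, hfix]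
    · have := huniq (1 - 2 * a) (by linarith [ha.2])
        ((half_one_sub_eq_iff_halfTanh_eq_self β a).1 h)
      linarith
    · filter_upwards [ae_exists_tendsto_occ hβ h2.ne' hα hℱ hcond hindep] with ω ⟨c, hc, hc0, h⟩
      have h1 : 1 - (1 - b) / 2 = (1 + b) / 2 := by ring
      rw [h1]
      rcases lt_or_gt_of_ne (hc0 h2) with hneg | hpos
      · have hcb := huniq (-c) (neg_pos.2 hneg) (by rw [halfTanh_neg, hc])
        rw [show c = -b by linarith, sub_neg_eq_add, ← sub_eq_add_neg] at h
        exact Or.inr h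
      · rw [huniq c hpos hc] at h
        exact Or.inl h
end
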